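/- arXiv:math/0301231 — 2 statements merged into one kernel-verified Lean document; each statement's English description precedes it below -/
import Mathlib

section
/- Let R be a commutative ring and let α_0, …, α_n be a regular sequence on R such that each α_i is a non-zero-divisor of R; let I = (α_0, …, α_n). Then each local cohomology functor H_I^i commutes with filtered colimits: for every filtered category J and every functor F from J to R-modules, the canonical map colim_{j∈J} H_I^i(F(j)) → H_I^i(colim_{j∈J} F(j)) is an isomorphism. -/
open CategoryTheory CategoryTheory.Limits

universe u

namespace Module

variable {R : Type u} [CommRing R]

/-- A module is of type `FP_∞` if it belongs to a class of modules each of which is the quotient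
of a finite free module by a submodule in the same class, i.e. if it admits a resolution by
finite free modules. -/
def IsFPInfinity (R : Type u) [CommRing R] (M : Type u) [AddCommGroup M] [Module R M] : Prop :=
  ∃ S : ModuleCat.{u} R → Prop, S (.of R M) ∧ ∀ N, S N → ∃ (F : ModuleCat.{u} R)
    (p : F →ₗ[R] N), Module.Free R F ∧ Module.Finite R F ∧ Function.Surjective p ∧
      S (.of R (LinearMap.ker p))

namespace IsFPInfinity

variable {M : Type u} [AddCommGroup M] [Module R M]

lemma exists_cover (h : IsFPInfinity R M) : ∃ (F : ModuleCat.{u} R) (p : F →ₗ[R] M),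
    Module.Free R F ∧ Module.Finite R F ∧ Function.Surjective p ∧
      IsFPInfinity R (LinearMap.ker p) := by
  obtain ⟨S, hM, hS⟩ := h
  obtain ⟨F, p, hF, hF', hp, hK⟩ := hS _ hM
  exact ⟨F, p, hF, hF', hp, S, hK, hS⟩

lemma of_cover {F : Type u} [AddCommGroup F] [Module R F] [Module.Free R F] [Module.Finite R F]
    (p : F →ₗ[R] M) (hp : Function.Surjective p) (h : IsFPInfinity R (LinearMap.ker p)) :
    IsFPInfinity R M := by
  refine ⟨fun N ↦ ∃ (F : ModuleCat.{u} R) (p : F →ₗ[R] N), Module.Free R F ∧ Module.Finite R F ∧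
    Function.Surjective p ∧ IsFPInfinity R (LinearMap.ker p),
    ⟨.of R F, p, ‹_›, ‹_›, hp, h⟩, ?_⟩
  rintro N ⟨F, p, hF, hF', hp, hK⟩
  exact ⟨F, p, hF, hF', hp, hK.exists_cover⟩

lemma of_linearEquiv {N : Type u} [AddCommGroup N] [Module R N] (h : IsFPInfinity R M)
    (e : M ≃ₗ[R] N) : IsFPInfinity R N := by
  obtain ⟨F, p, hF, hF', hp, hK⟩ := h.exists_cover
  refine of_cover (e.toLinearMap ∘ₗ p) (e.surjective.comp hp) ?_
  rwa [LinearEquiv.ker_comp]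

lemma of_subsingleton [Subsingleton M] : IsFPInfinity R M := by
  refine ⟨fun N ↦ Subsingleton N, ‹_›, fun N hN ↦ ⟨.of R PUnit, 0, ?_, ?_, ?_, ?_⟩⟩
  · exact inferInstanceAs (Module.Free R PUnit.{u + 1})
  · exact inferInstanceAs (Module.Finite R PUnit.{u + 1})
  · exact fun _ ↦ ⟨0, Subsingleton.elim _ _⟩
  · exact inferInstanceAs (Subsingleton (LinearMap.ker (0 : PUnit.{u + 1} →ₗ[R] N)))

lemma of_free [Module.Free R M] [Module.Finite R M] : IsFPInfinity R M := by
  refine of_cover LinearMap.id Function.surjective_id ?_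
  rw [LinearMap.ker_id]
  exact of_subsingleton

/-- Modules of type `FP_∞` are closed under extensions. -/
lemma of_extension {A B C : Type u} [AddCommGroup A] [Module R A] [AddCommGroup B] [Module R B]
    [AddCommGroup C] [Module R C] {f : A →ₗ[R] B} {g : B →ₗ[R] C} (hf : Function.Injective f)
    (hfg : Function.Exact f g) (hg : Function.Surjective g)
    (hA : IsFPInfinity R A) (hC : IsFPInfinity R C) : IsFPInfinity R B := by
  refine ⟨fun B ↦ ∃ (A C : ModuleCat.{u} R) (f : A →ₗ[R] B) (g : B →ₗ[R] C),
    Function.Injective f ∧ Function.Exact f g ∧ Function.Surjective g ∧ IsFPInfinity R A ∧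
      IsFPInfinity R C, ⟨.of R A, .of R C, f, g, hf, hfg, hg, hA, hC⟩, ?_⟩
  clear hf hfg hg hA hC f g
  rintro B ⟨A, C, f, g, hf, hfg, hg, hA, hC⟩
  obtain ⟨F, p, hF, hF', hp, hK⟩ := hA.exists_cover
  obtain ⟨G, q, hG, hG', hq, hL⟩ := hC.exists_cover
  obtain ⟨l, hl⟩ := Module.projective_lifting_property g q hg
  have hl' (x) : g (l x) = q x := LinearMap.congr_fun hl x
  have hgf (x) : g (f x) = 0 := hfg.apply_apply_eq_zero x
  let h : F × G →ₗ[R] B := (f ∘ₗ p).coprod l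
  have hh (x) : h x = f (p x.1) + l x.2 := rfl
  refine ⟨.of R (F × G), h, ?_, ?_, ?_, .of R (LinearMap.ker p), .of R (LinearMap.ker q),
    (LinearMap.inl R F G).restrict (p := LinearMap.ker p) (q := LinearMap.ker h) ?_,
    (LinearMap.snd R F G).restrict (p := LinearMap.ker h) (q := LinearMap.ker q) ?_,
    ?_, ?_, ?_, hK, hL⟩
  · exact inferInstanceAs (Module.Free R (F × G))
  · exact inferInstanceAs (Module.Finite R (F × G))
  · intro b
    obtain ⟨y, hy⟩ := hq (g b)
    obtain ⟨a, ha⟩ := (hfg (b - l y)).1 (by rw [map_sub, hl', hy, sub_self])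
    obtain ⟨x, rfl⟩ := hp a
    exact ⟨(x, y), by rw [hh, ha, sub_add_cancel]⟩
  · intro x hx
    simp_all
  · intro x hx
    have := congrArg g (LinearMap.mem_ker.1 hx)
    simpa [hh, hl', hgf] using this
  · intro x y hxy
    exact Subtype.ext (congrArg (fun z ↦ z.1.1) hxy)
  · rintro ⟨⟨x, y⟩, hxy⟩
    constructor
    · intro hy
      obtain rfl : y = 0 := congrArg Subtype.val hy
      have hx : p x = 0 := hf (by simpa [hh] using hxy)
      exact ⟨⟨x, hx⟩, rfl⟩
    · rintro ⟨z, hz⟩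
      exact Subtype.ext (congrArg (fun w ↦ w.1.2) hz).symm
  · rintro ⟨y, hy⟩
    obtain ⟨a, ha⟩ := (hfg (l y)).1 (by rw [hl', LinearMap.mem_ker.1 hy])
    obtain ⟨x, rfl⟩ := hp a
    exact ⟨⟨(-x, y), by simp [hh, ha]⟩, rfl⟩

/-- The cokernel of an injective map between modules of type `FP_∞` is of type `FP_∞`. -/
lemma of_coker {A B C : Type u} [AddCommGroup A] [Module R A] [AddCommGroup B] [Module R B]
    [AddCommGroup C] [Module R C] {f : A →ₗ[R] B} {g : B →ₗ[R] C} (hf : Function.Injective f)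
    (hfg : Function.Exact f g) (hg : Function.Surjective g)
    (hA : IsFPInfinity R A) (hB : IsFPInfinity R B) : IsFPInfinity R C := by
  obtain ⟨F, p, hF, hF', hp, hK⟩ := hB.exists_cover
  refine of_cover (g ∘ₗ p) (hg.comp hp) ?_
  have hker : IsFPInfinity R (LinearMap.ker g) :=
    hA.of_linearEquiv ((LinearEquiv.ofInjective f hf).trans
      (LinearEquiv.ofEq _ _ hfg.linearMap_ker_eq.symm))
  refine of_extension (f := Submodule.inclusion (LinearMap.ker_le_ker_comp p g))
    (g := p.restrict (p := LinearMap.ker (g ∘ₗ p)) (q := LinearMap.ker g) fun x hx ↦ hx)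
    (Submodule.inclusion_injective _) ?_ ?_ hK hker
  · rintro ⟨x, hx⟩
    constructor
    · intro h
      exact ⟨⟨x, congrArg Subtype.val h⟩, rfl⟩
    · rintro ⟨y, hy⟩
      obtain rfl : y.1 = x := congrArg Subtype.val hy
      exact Subtype.ext y.2
  · rintro ⟨b, hb⟩
    obtain ⟨x, rfl⟩ := hp b
    exact ⟨⟨x, hb⟩, rfl⟩

lemma quotSMulTop (h : IsFPInfinity R M) {r : R} (hr : IsSMulRegular M r) :
    IsFPInfinity R (QuotSMulTop r M) := by
  refine of_coker (f := LinearMap.lsmul R M r) (g := Submodule.mkQ _) hr ?_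
    (Submodule.mkQ_surjective _) h h
  intro x
  simp [Submodule.mem_smul_pointwise_iff_exists]

open RingTheory.Sequence in
/-- The quotient of a module of type `FP_∞` by a weakly regular sequence is of type `FP_∞`. -/
lemma quotient_ofList_smul_top {rs : List R} (h : IsFPInfinity R M) (hrs : IsWeaklyRegular M rs) :
    IsFPInfinity R (M ⧸ (Ideal.ofList rs • ⊤ : Submodule R M)) := by
  induction rs generalizing M with
  | nil =>
    refine h.of_linearEquiv (Submodule.quotEquivOfEqBot _ ?_).symm
    rw [Ideal.ofList_nil, Submodule.bot_smul]
  | cons r rs ih =>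
    rw [isWeaklyRegular_cons_iff] at hrs
    exact (ih (h.quotSMulTop hrs.1) hrs.2).of_linearEquiv
      (Submodule.quotOfListConsSMulTopEquivQuotSMulTopInner M r rs).symm

end IsFPInfinity

end Module

namespace RingTheory.Sequence

variable {R : Type*} [CommRing R]

open scoped Pointwise

lemma isWeaklyRegular_of_subsingleton (M : Type*) [AddCommGroup M] [Module R M] [Subsingleton M]
    (rs : List R) : IsWeaklyRegular M rs :=
  ⟨fun _ _ _ _ _ ↦ Subsingleton.elim _ _⟩

/-- Weak regularity of a sequence is inherited by extensions. -/
lemma IsWeaklyRegular.of_extension {A B C : Type*} [AddCommGroup A] [Module R A] [AddCommGroup B]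
    [Module R B] [AddCommGroup C] [Module R C] {f : A →ₗ[R] B} {g : B →ₗ[R] C}
    (hf : Function.Injective f) (hfg : Function.Exact f g) (hg : Function.Surjective g)
    {rs : List R} (hA : IsWeaklyRegular A rs) (hC : IsWeaklyRegular C rs) :
    IsWeaklyRegular B rs := by
  induction rs generalizing A B C with
  | nil => exact .nil R B
  | cons r rs ih =>
    rw [isWeaklyRegular_cons_iff] at hA hC ⊢
    refine ⟨isSMulRegular_of_range_eq_ker hf hfg.linearMap_ker_eq.symm hA.1 hC.1,
      ih (f := QuotSMulTop.map r f) (g := QuotSMulTop.map r g) ?_ (QuotSMulTop.map_exact r hfg hg)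
        (QuotSMulTop.map_surjective r hg) hA.2 hC.2⟩
    have := QuotSMulTop.map_first_exact_on_four_term_exact_of_isSMulRegular_last
      (f₁ := (0 : A →ₗ[R] A)) ((LinearMap.exact_zero_iff_injective A f).2 hf) hfg hC.1
    rw [map_zero] at this
    exact (LinearMap.exact_zero_iff_injective _ _).1 this

lemma IsWeaklyRegular.quotSMulTop_pow {M : Type*} [AddCommGroup M] [Module R M] {r : R}
    {rs : List R} (hr : IsSMulRegular M r) (hrs : IsWeaklyRegular (QuotSMulTop r M) rs) (k : ℕ) :
    IsWeaklyRegular (QuotSMulTop (r ^ k) M) rs := by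
  induction k with
  | zero =>
    have : Subsingleton (QuotSMulTop (r ^ 0) M) := by
      rw [Submodule.Quotient.subsingleton_iff, pow_zero, one_smul]
    exact isWeaklyRegular_of_subsingleton _ _
  | succ k ih =>
    refine of_extension
      (f := Submodule.mapQ (r ^ k • ⊤ : Submodule R M) (r ^ (k + 1) • ⊤ : Submodule R M)
        (LinearMap.lsmul R M r) ?_)
      (g := Submodule.factor ?_) ?_ ?_ ?_ ih hrs
    · rintro _ ⟨x, -, rfl⟩
      exact ⟨x, trivial, by simp [pow_succ', mul_smul, smul_comm r]⟩
    · rintro _ ⟨x, -, rfl⟩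
      exact ⟨r ^ k • x, trivial, by simp [pow_succ', mul_smul, smul_comm r]⟩
    · rw [injective_iff_map_eq_zero]
      intro x hx
      obtain ⟨x, rfl⟩ := Submodule.Quotient.mk_surjective _ x
      rw [Submodule.mapQ_apply, Submodule.Quotient.mk_eq_zero] at hx
      obtain ⟨y, -, hy⟩ := hx
      rw [Submodule.Quotient.mk_eq_zero]
      refine ⟨y, trivial, hr ?_⟩
      simpa [pow_succ', mul_smul] using hy
    · intro x
      obtain ⟨x, rfl⟩ := Submodule.Quotient.mk_surjective _ x
      constructor
      · intro hx
        erw [Submodule.factor_mk, Submodule.Quotient.mk_eq_zero] at hx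
        obtain ⟨y, -, rfl⟩ := hx
        exact ⟨Submodule.Quotient.mk y, rfl⟩
      · rintro ⟨y, hy⟩
        obtain ⟨y, rfl⟩ := Submodule.Quotient.mk_surjective _ y
        rw [← hy]
        refine (Submodule.Quotient.mk_eq_zero _).2 ?_
        exact ⟨y, trivial, rfl⟩
    · exact Submodule.factor_surjective _

lemma IsWeaklyRegular.map_pow {M : Type*} [AddCommGroup M] [Module R M] {rs : List R}
    (hrs : IsWeaklyRegular M rs) (k : ℕ) : IsWeaklyRegular M (rs.map (· ^ k)) := by
  induction rs generalizing M with
  | nil => exact .nil R M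
  | cons r rs ih =>
    rw [isWeaklyRegular_cons_iff] at hrs
    rw [List.map_cons, isWeaklyRegular_cons_iff]
    exact ⟨hrs.1.pow k, ih (quotSMulTop_pow hrs.1 hrs.2 k)⟩

end RingTheory.Sequence

namespace ModuleCat

variable {R : Type u} [CommRing R]

section FilteredColimits

variable {J : Type*} [Category J]

/-- The elementwise description of filtered colimits of modules: every element of the point of
the cocone comes from some stage, and an element of some stage which vanishes in the point of the
cocone already vanishes at a later stage. -/
def IsElementwiseColimit {L : J ⥤ ModuleCat.{u} R} (c : Cocone L) : Prop :=
  (∀ x : c.pt, ∃ (j : J) (y : L.obj j), (c.ι.app j).hom y = x) ∧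
    ∀ (j : J) (y : L.obj j), (c.ι.app j).hom y = 0 → ∃ (k : J) (f : j ⟶ k), (L.map f).hom y = 0

variable {L : J ⥤ ModuleCat.{u} R} {c : Cocone L}

lemma IsElementwiseColimit.of_isColimit [IsFiltered J]
    [PreservesColimit L (forget (ModuleCat.{u} R))]
    (hc : IsColimit c) : IsElementwiseColimit c := by
  refine ⟨fun x ↦ Concrete.isColimit_exists_rep L hc x, fun j y hy ↦ ?_⟩
  obtain ⟨k, f, g, h⟩ := Concrete.isColimit_exists_of_rep_eq L hc y (0 : L.obj j)
    (hy.trans (map_zero (c.ι.app j).hom).symm)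
  exact ⟨k, f, h.trans (map_zero (L.map g).hom)⟩

lemma IsElementwiseColimit.nonempty_isColimit [IsFiltered J]
    [ReflectsColimit L (forget (ModuleCat.{u} R))]
    (hc : IsElementwiseColimit c) : Nonempty (IsColimit c) := by
  refine ⟨isColimitOfReflects (forget (ModuleCat.{u} R))
    (Types.FilteredColimit.isColimitOf' _ _ (fun x ↦ ?_) fun j x y hxy ↦ ?_)⟩
  · obtain ⟨j, y, hy⟩ := hc.1 x
    exact ⟨j, y, hy.symm⟩
  · have hxy' : (c.ι.app j).hom (show L.obj j from x) = (c.ι.app j).hom (show L.obj j from y) := hxy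
    obtain ⟨k, f, hf⟩ := hc.2 j ((show L.obj j from x) - (show L.obj j from y))
      (by rw [map_sub, hxy', sub_self])
    rw [map_sub, sub_eq_zero] at hf
    exact ⟨k, f, hf⟩

/-- Homology of short complexes of modules commutes with filtered colimits. -/
lemma IsElementwiseColimit.mapCocone_homologyFunctor [IsFiltered J]
    {T : J ⥤ ShortComplex (ModuleCat.{u} R)}
    {d : Cocone T} (h₁ : IsElementwiseColimit (ShortComplex.π₁.mapCocone d))
    (h₂ : IsElementwiseColimit (ShortComplex.π₂.mapCocone d))
    (h₃ : IsElementwiseColimit (ShortComplex.π₃.mapCocone d)) :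
    IsElementwiseColimit ((ShortComplex.homologyFunctor (ModuleCat.{u} R)).mapCocone d) := by
  have surj (S : ShortComplex (ModuleCat.{u} R)) (x : S.homology) :
      ∃ z : S.cycles, S.homologyπ.hom z = x := (ModuleCat.epi_iff_surjective _).1 inferInstance x
  have inj (S : ShortComplex (ModuleCat.{u} R)) : Function.Injective S.iCycles.hom :=
    (ModuleCat.mono_iff_injective _).1 inferInstance
  have lift (S : ShortComplex (ModuleCat.{u} R)) (x : S.X₂) (hx : S.g.hom x = 0) :
      ∃ z : S.cycles, S.iCycles.hom z = x :=
    (ShortComplex.moduleCat_exact_iff _).1 (ShortComplex.exact_of_f_is_kernel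
      (ShortComplex.mk S.iCycles S.g S.iCycles_g) S.cyclesIsKernel) x hx
  have bdry (S : ShortComplex (ModuleCat.{u} R)) (z : S.cycles) (hz : S.homologyπ.hom z = 0) :
      ∃ y : S.X₁, S.toCycles.hom y = z :=
    (ShortComplex.moduleCat_exact_iff _).1 (ShortComplex.exact_of_g_is_cokernel
      (ShortComplex.mk S.toCycles S.homologyπ S.toCycles_comp_homologyπ) S.homologyIsCokernel) z hz
  have natπ {S T : ShortComplex (ModuleCat.{u} R)} (φ : S ⟶ T) (z : S.cycles) :
      (ShortComplex.homologyMap φ).hom (S.homologyπ.hom z) =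
        T.homologyπ.hom ((ShortComplex.cyclesMap φ).hom z) :=
    congr($(ShortComplex.homologyπ_naturality φ).hom z)
  have nati {S T : ShortComplex (ModuleCat.{u} R)} (φ : S ⟶ T) (z : S.cycles) :
      T.iCycles.hom ((ShortComplex.cyclesMap φ).hom z) = φ.τ₂.hom (S.iCycles.hom z) :=
    congr($(ShortComplex.cyclesMap_i φ).hom z)
  have hti (S : ShortComplex (ModuleCat.{u} R)) (y : S.X₁) :
      S.iCycles.hom (S.toCycles.hom y) = S.f.hom y :=
    congr($(S.toCycles_i).hom y)
  have hτ₃ {S T : ShortComplex (ModuleCat.{u} R)} (φ : S ⟶ T) (x : S.X₂) :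
      T.g.hom (φ.τ₂.hom x) = φ.τ₃.hom (S.g.hom x) := congr($(φ.comm₂₃).hom x)
  have hτ₁ {S T : ShortComplex (ModuleCat.{u} R)} (φ : S ⟶ T) (x : S.X₁) :
      T.f.hom (φ.τ₁.hom x) = φ.τ₂.hom (S.f.hom x) := congr($(φ.comm₁₂).hom x)
  have hπf (S : ShortComplex (ModuleCat.{u} R)) (y : S.X₁) :
      S.homologyπ.hom (S.toCycles.hom y) = 0 :=
    congr($(S.toCycles_comp_homologyπ).hom y)
  have hig (S : ShortComplex (ModuleCat.{u} R)) (z : S.cycles) : S.g.hom (S.iCycles.hom z) = 0 :=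
    congr($(S.iCycles_g).hom z)
  have surj₁ : ∀ x : d.pt.X₁, ∃ (j : J) (y : (T.obj j).X₁), (d.ι.app j).τ₁.hom y = x := h₁.1
  have surj₂ : ∀ x : d.pt.X₂, ∃ (j : J) (y : (T.obj j).X₂), (d.ι.app j).τ₂.hom y = x := h₂.1
  have inj₂ : ∀ (j : J) (y : (T.obj j).X₂), (d.ι.app j).τ₂.hom y = 0 →
    ∃ (k : J) (f : j ⟶ k), (T.map f).τ₂.hom y = 0 := h₂.2
  have inj₃ : ∀ (j : J) (y : (T.obj j).X₃), (d.ι.app j).τ₃.hom y = 0 →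
    ∃ (k : J) (f : j ⟶ k), (T.map f).τ₃.hom y = 0 := h₃.2
  have hw {j k : J} (f : j ⟶ k) (y : (T.obj j).X₂) :
      (d.ι.app k).τ₂.hom ((T.map f).τ₂.hom y) = (d.ι.app j).τ₂.hom y :=
    congr(($(d.w f)).τ₂.hom y)
  constructor
  · intro x
    obtain ⟨z, rfl⟩ := surj _ x
    obtain ⟨j, y, hy⟩ := surj₂ (d.pt.iCycles.hom z)
    obtain ⟨k, f, hf⟩ := inj₃ j ((T.obj j).g.hom y)
      ((hτ₃ (d.ι.app j) y).symm.trans ((congrArg d.pt.g.hom hy).trans (hig _ z)))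
    obtain ⟨w, hw'⟩ := lift _ _ ((hτ₃ (T.map f) y).trans hf)
    refine ⟨k, (T.obj k).homologyπ.hom w,
      (natπ (d.ι.app k) w).trans (congrArg d.pt.homologyπ.hom (inj _ ?_))⟩
    refine (nati (d.ι.app k) w).trans (Eq.trans ?_ ((hw f y).trans hy))
    exact congrArg _ hw'
  · intro j x hx
    obtain ⟨z, rfl⟩ := surj _ x
    obtain ⟨y, hy⟩ := bdry _ _ ((natπ (d.ι.app j) z).symm.trans hx)
    obtain ⟨i, y, rfl⟩ := surj₁ y
    replace hy : (d.ι.app i).τ₂.hom ((T.obj i).f.hom y) =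
        (d.ι.app j).τ₂.hom ((T.obj j).iCycles.hom z) :=
      (hτ₁ (d.ι.app i) y).symm.trans ((hti _ _).symm.trans
        ((congrArg d.pt.iCycles.hom hy).trans (nati (d.ι.app j) z)))
    obtain ⟨l, f, hf⟩ := inj₂ (IsFiltered.max i j)
      ((T.map (IsFiltered.leftToMax i j)).τ₂.hom ((T.obj i).f.hom y) -
        (T.map (IsFiltered.rightToMax i j)).τ₂.hom ((T.obj j).iCycles.hom z))
      ((map_sub _ _ _).trans (sub_eq_zero.2 ((hw (IsFiltered.leftToMax i j) _).trans
        (hy.trans (hw (IsFiltered.rightToMax i j) _).symm))))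
    rw [map_sub, sub_eq_zero] at hf
    refine ⟨l, IsFiltered.rightToMax i j ≫ f, (natπ _ z).trans ?_⟩
    refine Eq.trans (congrArg _ (inj _ ?_))
      (hπf _ ((T.map (IsFiltered.leftToMax i j ≫ f)).τ₁.hom y))
    rw [nati, hti, hτ₁, T.map_comp, T.map_comp]
    exact hf.symm

/-- Maps out of a finite free module commute with filtered colimits. -/
lemma IsElementwiseColimit.mapCocone_linearCoyoneda [IsFiltered J] (hc : IsElementwiseColimit c)
    (F : ModuleCat.{u} R) [Module.Free R F] [Module.Finite R F] :
    IsElementwiseColimit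
      (((linearCoyoneda R (ModuleCat.{u} R)).obj (Opposite.op F)).mapCocone c) := by
  classical
  let b := Module.Free.chooseBasis R F
  have hw {j k : J} (f : j ⟶ k) (y : L.obj j) :
      (c.ι.app k).hom ((L.map f).hom y) = (c.ι.app j).hom y := congr(($(c.w f)).hom y)
  constructor
  · intro (x : F ⟶ c.pt)
    have key (s : Finset (Module.Free.ChooseBasisIndex R F)) :
        ∃ (j : J) (y : Module.Free.ChooseBasisIndex R F → L.obj j),
          ∀ i ∈ s, (c.ι.app j).hom (y i) = x.hom (b i) := by
      induction s using Finset.induction_on with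
      | empty => exact ⟨(IsFiltered.nonempty (C := J)).some, 0, by simp⟩
      | insert a s ha ih =>
        obtain ⟨j, y, hy⟩ := ih
        obtain ⟨k, z, hz⟩ := hc.1 (x.hom (b a))
        refine ⟨IsFiltered.max j k, fun i ↦ if i = a then (L.map (IsFiltered.rightToMax j k)).hom z
          else (L.map (IsFiltered.leftToMax j k)).hom (y i), fun i hi ↦ ?_⟩
        beta_reduce
        split_ifs with h
        · subst h
          exact (hw (IsFiltered.rightToMax j k) z).trans hz
        · exact (hw (IsFiltered.leftToMax j k) (y i)).trans
            (hy i ((Finset.mem_insert.1 hi).resolve_left h))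
    obtain ⟨j, y, hy⟩ := key Finset.univ
    refine ⟨j, (ModuleCat.ofHom (b.constr R y) : F ⟶ L.obj j), ?_⟩
    refine ModuleCat.hom_ext (b.ext fun i ↦ ?_)
    exact (congrArg (c.ι.app j).hom (b.constr_basis R y i)).trans (hy i (Finset.mem_univ i))
  · intro j (y : F ⟶ L.obj j) hy
    replace hy : y ≫ c.ι.app j = 0 := hy
    have key (s : Finset (Module.Free.ChooseBasisIndex R F)) :
        ∃ (k : J) (f : j ⟶ k), ∀ i ∈ s, (L.map f).hom (y.hom (b i)) = 0 := by
      induction s using Finset.induction_on with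
      | empty => exact ⟨j, 𝟙 j, by simp⟩
      | insert a s ha ih =>
        obtain ⟨k, f, hf⟩ := ih
        obtain ⟨l, g, hg⟩ := hc.2 k ((L.map f).hom (y.hom (b a)))
          ((hw f _).trans congr(($hy).hom (b a)))
        refine ⟨l, f ≫ g, fun i hi ↦ ?_⟩
        rw [L.map_comp, ModuleCat.comp_apply]
        obtain rfl | hi := Finset.mem_insert.1 hi
        · exact hg
        · rw [hf i hi, map_zero]
    obtain ⟨k, f, hf⟩ := key Finset.univ
    refine ⟨k, f, ?_⟩
    change y ≫ L.map f = 0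
    exact ModuleCat.hom_ext (b.ext fun i ↦ hf i (Finset.mem_univ i))

/-- A colimit of functors which commute with a filtered colimit commutes with it. -/
lemma IsElementwiseColimit.mapCocone_colimit {K : Type*} [Category K] [IsFiltered K]
    [HasColimitsOfShape K (ModuleCat.{u} R)]
    [PreservesColimitsOfShape K (forget (ModuleCat.{u} R))]
    (D : K ⥤ ModuleCat.{u} R ⥤ ModuleCat.{u} R)
    (h : ∀ k, IsElementwiseColimit ((D.obj k).mapCocone c)) :
    IsElementwiseColimit ((colimit D).mapCocone c) := by
  have hD (X : ModuleCat.{u} R) := of_isColimit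
    (isColimitOfPreserves ((evaluation _ _).obj X) (colimit.isColimit D))
  have nat (k : K) {X Y : ModuleCat.{u} R} (f : X ⟶ Y) (x : (D.obj k).obj X) :
      ((colimit D).map f).hom (((colimit.ι D k).app X).hom x) =
        ((colimit.ι D k).app Y).hom (((D.obj k).map f).hom x) :=
    congr($((colimit.ι D k).naturality f).hom x).symm
  have nat' {k l : K} (g : k ⟶ l) {X Y : ModuleCat.{u} R} (f : X ⟶ Y) (x : (D.obj k).obj X) :
      ((D.obj l).map f).hom (((D.map g).app X).hom x) =
        ((D.map g).app Y).hom (((D.obj k).map f).hom x) :=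
    congr($((D.map g).naturality f).hom x).symm
  constructor
  · intro x
    obtain ⟨k, y, rfl⟩ := (hD _).1 x
    obtain ⟨j, z, rfl⟩ := (h k).1 y
    exact ⟨j, ((colimit.ι D k).app _).hom z, nat k _ z⟩
  · intro j x hx
    obtain ⟨k, y, rfl⟩ := (hD _).1 x
    obtain ⟨l, g, hg⟩ := (hD _).2 k _ ((nat k (c.ι.app j) y).symm.trans hx)
    obtain ⟨i, f, hf⟩ := (h l).2 j (((D.map g).app _).hom y) ((nat' g _ y).trans hg)
    refine ⟨i, f, ?_⟩
    have hy : ((colimit.ι D k).app _).hom y =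
        ((colimit.ι D l).app _).hom (((D.map g).app _).hom y) :=
      congr((($(colimit.w D g)).app _).hom y).symm
    change ((colimit D).map _).hom (((colimit.ι D k).app _).hom y) = 0
    rw [hy, nat]
    exact (congrArg _ hf).trans (map_zero _)

/-- Being an elementwise colimit only depends on the functor up to isomorphism. -/
lemma IsElementwiseColimit.mapCocone_of_natIso {C : Type*} [Category C] {L : J ⥤ C} {c : Cocone L}
    {G H : C ⥤ ModuleCat.{u} R} (e : G ≅ H) (h : IsElementwiseColimit (G.mapCocone c)) :
    IsElementwiseColimit (H.mapCocone c) := by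
  have nat {X Y : C} (f : X ⟶ Y) (x : G.obj X) :
      (H.map f).hom ((e.hom.app X).hom x) = (e.hom.app Y).hom ((G.map f).hom x) :=
    congr($(e.hom.naturality f).hom x).symm
  have surj (X : C) (y : H.obj X) : ∃ x, (e.hom.app X).hom x = y :=
    (ModuleCat.epi_iff_surjective _).1 inferInstance y
  have inj (X : C) : Function.Injective (e.hom.app X).hom :=
    (ModuleCat.mono_iff_injective _).1 inferInstance
  constructor
  · intro x
    obtain ⟨x, rfl⟩ := surj _ x
    obtain ⟨j, y, rfl⟩ := h.1 x
    exact ⟨j, _, nat _ y⟩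
  · intro j x hx
    obtain ⟨x, rfl⟩ := surj _ x
    obtain ⟨k, f, hf⟩ := h.2 j x (inj _ (((nat _ x).symm.trans hx).trans (map_zero _).symm))
    exact ⟨k, f, (nat _ x).trans ((congrArg _ hf).trans (map_zero _))⟩

end FilteredColimits

end ModuleCat

namespace Module.IsFPInfinity

variable {R : Type u} [CommRing R] {M : Type u} [AddCommGroup M] [Module R M]

/-- A module of type `FP_∞` has a projective resolution by finite free modules. -/
lemma exists_projectiveResolution (h : IsFPInfinity R M) :
    ∃ P : ProjectiveResolution (ModuleCat.of R M),
      ∀ n, Module.Free R (P.complex.X n) ∧ Module.Finite R (P.complex.X n) := by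
  choose F p hF hF' hp hK using fun N : {N : ModuleCat.{u} R // IsFPInfinity R N} ↦
    exists_cover N.2
  let syz (n : ℕ) : {N : ModuleCat.{u} R // IsFPInfinity R N} :=
    n.rec ⟨.of R M, h⟩ fun _ N ↦ ⟨.of R (LinearMap.ker (p N)), hK N⟩
  let d (n : ℕ) : F (syz (n + 1)) →ₗ[R] F (syz n) :=
    (LinearMap.ker (p (syz n))).subtype ∘ₗ p (syz (n + 1))
  have hd (n : ℕ) : LinearMap.range (d n) = LinearMap.ker (p (syz n)) :=
    (LinearMap.range_comp_of_range_eq_top _ (LinearMap.range_eq_top.2 (hp (syz (n + 1))))).trans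
      (Submodule.range_subtype _)
  have hd' (n : ℕ) : LinearMap.ker (d n) = LinearMap.ker (p (syz (n + 1))) :=
    LinearMap.ker_comp_of_ker_eq_bot _ (Submodule.ker_subtype _)
  have hproj (n : ℕ) : CategoryTheory.Projective (F (syz n)) := by
    have := hF (syz n)
    exact ModuleCat.projective_of_free (Module.Free.chooseBasis R (F (syz n)))
  have sq (n : ℕ) : ModuleCat.ofHom (d (n + 1)) ≫ ModuleCat.ofHom (d n) = 0 :=
    ModuleCat.hom_ext (LinearMap.range_le_ker_iff.1 ((hd (n + 1)).trans (hd' n).symm).le)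
  let K : ChainComplex (ModuleCat.{u} R) ℕ :=
    ChainComplex.of (fun n ↦ F (syz n)) (fun n ↦ ModuleCat.ofHom (d n)) sq
  have hKd (n : ℕ) : K.d (n + 1) n = ModuleCat.ofHom (d n) :=
    ChainComplex.of_d (fun n ↦ F (syz n)) (fun n ↦ ModuleCat.ofHom (d n)) n
  let π₀ : K.X 0 ⟶ ModuleCat.of R M := ModuleCat.ofHom (p (syz 0))
  have hπ₀ : K.d 1 0 ≫ π₀ = 0 := by
    rw [hKd]
    exact ModuleCat.hom_ext (LinearMap.range_le_ker_iff.1 (hd 0).le)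
  have hπ₀' : Epi π₀ := (ModuleCat.epi_iff_surjective _).2 (hp (syz 0))
  let π := (ChainComplex.toSingle₀Equiv K (ModuleCat.of R M)).symm ⟨π₀, hπ₀⟩
  have hex₀ : (ShortComplex.mk (K.d 1 0) π₀ hπ₀).Exact := by
    rw [ShortComplex.moduleCat_exact_iff_ker_sub_range]
    exact (hd 0).ge.trans_eq congr(LinearMap.range ($(hKd 0)).hom).symm
  have hex (n : ℕ) : K.ExactAt (n + 1) := by
    rw [HomologicalComplex.exactAt_iff' K (n + 1 + 1) (n + 1) n (by simp) (by simp),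
      ShortComplex.moduleCat_exact_iff_ker_sub_range]
    change LinearMap.ker (K.d (n + 1) n).hom ≤ LinearMap.range (K.d (n + 1 + 1) (n + 1)).hom
    rw [hKd, hKd]
    exact ((hd' n).trans (hd (n + 1)).symm).le
  refine ⟨{ complex := K, projective := hproj, π := π, quasiIso := ⟨fun n ↦ ?_⟩ },
    fun n ↦ ⟨hF (syz n), hF' (syz n)⟩⟩
  cases n with
  | zero =>
    rw [ChainComplex.quasiIsoAt₀_iff, ShortComplex.quasiIso_iff_of_zeros']
    · refine (ShortComplex.exact_and_epi_g_iff_of_iso ?_).2 ⟨hex₀, hπ₀'⟩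
      exact ShortComplex.isoMk (Iso.refl _) (Iso.refl _) (Iso.refl _)
        ((Category.id_comp (K.d 1 0)).trans (Category.comp_id (K.d 1 0)).symm)
        ((Category.id_comp π₀).trans ((Category.comp_id (π.f 0)).trans
          (ChainComplex.toSingle₀Equiv_symm_apply_f_zero π₀ hπ₀)).symm)
    all_goals rfl
  | succ n =>
    rw [quasiIsoAt_iff_exactAt']
    · exact hex n
    · exact ChainComplex.exactAt_succ_single_obj _ _

end Module.IsFPInfinity

namespace CategoryTheory.ProjectiveResolution

open Opposite

variable {R : Type*} [Ring R] {C : Type*} [Category C] [Abelian C] [Linear R C]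
  [EnoughProjectives C] {X : C} (P : ProjectiveResolution X)

variable (R) in
/-- The functor sending `Y` to the complex of morphisms from a projective resolution to `Y`. -/
noncomputable def homComplexFunctor : C ⥤ CochainComplex (ModuleCat R) ℕ where
  obj Y := P.complex.linearYonedaObj R Y
  map f := (HomologicalComplex.unopFunctor _ _).map
    ((NatTrans.mapHomologicalComplex (NatTrans.rightOp ((linearYoneda R C).map f)) _).app
      P.complex).op
  map_id Y := by
    ext i x
    exact Category.comp_id (obj := C) x
  map_comp f g := by
    ext i x
    exact (Category.assoc (obj := C) x f g).symm

lemma isoExt_hom_naturality (n : ℕ) {Y Z : C} (f : Y ⟶ Z) :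
    ((Ext R C n).obj (op X)).map f ≫ (P.isoExt n Z).hom =
      (P.isoExt n Y).hom ≫ HomologicalComplex.homologyMap ((P.homComplexFunctor R).map f) n := by
  let α := NatTrans.rightOp ((linearYoneda R C).map f)
  let aY := P.isoLeftDerivedObj ((linearYoneda R C).obj Y).rightOp n
  let aZ := P.isoLeftDerivedObj ((linearYoneda R C).obj Z).rightOp n
  let hY := ((P.homComplexFunctor R).obj Y).homologyOp n
  let hZ := ((P.homComplexFunctor R).obj Z).homologyOp n
  let g := (HomologicalComplex.homologyFunctor _ (ComplexShape.down ℕ) n).map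
    ((NatTrans.mapHomologicalComplex α _).app P.complex)
  let m := (HomologicalComplex.homologyMap ((P.homComplexFunctor R).map f) n).op
  let eY : (((linearYoneda R C).obj Y).rightOp.leftDerived n).obj X ≅
    op (((P.homComplexFunctor R).obj Y).homology n) := aY ≪≫ hY
  let eZ : (((linearYoneda R C).obj Z).rightOp.leftDerived n).obj X ≅
    op (((P.homComplexFunctor R).obj Z).homology n) := aZ ≪≫ hZ
  have h₁ : (NatTrans.leftDerived α n).app X ≫ aY.hom = aZ.hom ≫ g :=
    (Iso.eq_comp_inv aY).1 ((leftDerived_app_eq α P n).trans (Category.assoc _ _ _).symm)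
  have h₂ : g ≫ hY.hom = hZ.hom ≫ m :=
    HomologicalComplex.homologyOp_hom_naturality ((P.homComplexFunctor R).map f) n
  have h₃ : (NatTrans.leftDerived α n).app X ≫ eY.hom = eZ.hom ≫ m :=
    (Category.assoc _ aY.hom hY.hom).symm.trans ((congrArg (· ≫ hY.hom) h₁).trans
      ((Category.assoc aZ.hom g hY.hom).trans ((congrArg (aZ.hom ≫ ·) h₂).trans
        (Category.assoc aZ.hom hZ.hom m).symm)))
  have h₄ : eZ.inv ≫ (NatTrans.leftDerived α n).app X = m ≫ eY.inv :=
    (Iso.inv_comp_eq eZ).2 (((Iso.eq_comp_inv eY).2 h₃).trans (Category.assoc _ _ _))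
  exact congrArg Quiver.Hom.unop h₄

/-- Computing `Ext` by a projective resolution is functorial in the second argument. -/
noncomputable def extFunctorIso (n : ℕ) :
    (Ext R C n).obj (op X) ≅ P.homComplexFunctor R ⋙ HomologicalComplex.homologyFunctor _ _ n :=
  NatIso.ofComponents (P.isoExt n) (P.isoExt_hom_naturality n)

end CategoryTheory.ProjectiveResolution

namespace Module.IsFPInfinity

open Opposite ModuleCat

/-- If `M` is of type `FP_∞`, then `Ext^n(M, -)` commutes with filtered colimits. -/
lemma isElementwiseColimit_mapCocone_ext {R : Type u} [CommRing R] {M : Type u} [AddCommGroup M]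
    [Module R M] (h : IsFPInfinity R M) (n : ℕ) {J : Type*} [Category J] [IsFiltered J]
    {L : J ⥤ ModuleCat.{u} R} {c : Cocone L} (hc : IsElementwiseColimit c) :
    IsElementwiseColimit
      (((Ext R (ModuleCat.{u} R) n).obj (op (ModuleCat.of R M))).mapCocone c) := by
  obtain ⟨P, hP⟩ := h.exists_projectiveResolution
  have key (k : ℕ) : IsElementwiseColimit
      (((linearCoyoneda R (ModuleCat.{u} R)).obj (op (P.complex.X k))).mapCocone c) := by
    obtain ⟨_, _⟩ := hP k
    exact hc.mapCocone_linearCoyoneda _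
  refine IsElementwiseColimit.mapCocone_of_natIso (P.extFunctorIso n).symm ?_
  exact IsElementwiseColimit.mapCocone_homologyFunctor
    (d := (P.homComplexFunctor R ⋙ HomologicalComplex.shortComplexFunctor _ _ n).mapCocone c)
    (key _) (key _) (key _)

end Module.IsFPInfinity

namespace localCohomology

open Opposite

variable {R : Type u} [CommRing R]

/-- The ideals generated by the powers of the entries of a list. -/
def listPowersDiagram (rs : List R) : ℕᵒᵖ ⥤ Ideal R where
  obj k := Ideal.ofList (rs.map (· ^ k.unop))
  map {k l} f := homOfLE <| by
    have hkl : l.unop ≤ k.unop := leOfHom f.unop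
    refine Ideal.span_le.2 fun x hx ↦ ?_
    obtain ⟨r, hr, rfl⟩ := List.mem_map.1 hx
    exact Ideal.mem_of_dvd _ (pow_dvd_pow r hkl)
      (Ideal.subset_span (List.mem_map_of_mem (f := (· ^ l.unop)) hr))

lemma ofList_le_radical_ofList_map_pow (rs : List R) (k : ℕ) :
    Ideal.ofList rs ≤ (Ideal.ofList (rs.map (· ^ k))).radical :=
  Ideal.span_le.2 fun _ hr ↦
    ⟨k, Ideal.subset_span (List.mem_map_of_mem (f := (· ^ k)) hr)⟩

lemma ofList_map_pow_le_pow (rs : List R) (k : ℕ) :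
    Ideal.ofList (rs.map (· ^ k)) ≤ Ideal.ofList rs ^ k := by
  refine Ideal.span_le.2 fun x hx ↦ ?_
  obtain ⟨r, hr, rfl⟩ := List.mem_map.1 hx
  exact Ideal.pow_mem_pow (Ideal.subset_span (s := {r | r ∈ rs}) hr) k

/-- Decreasing sequences of ideals which are eventually contained in every ideal with radical
containing `I` compute local cohomology. -/
lemma initial_of_forall_exists_le {I : Ideal R} (D : ℕᵒᵖ ⥤ SelfLERadical I)
    (h : ∀ K : SelfLERadical I, ∃ k : ℕ, (D.obj (op k)).obj ≤ K.obj) : D.Initial where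
  out K := by
    have : Nonempty (CostructuredArrow D K) := by
      obtain ⟨k, hk⟩ := h K
      exact ⟨CostructuredArrow.mk (⟨⟨⟨hk⟩⟩⟩ : D.obj (op k) ⟶ K)⟩
    refine zigzag_isConnected fun j₁ j₂ ↦ Relation.ReflTransGen.single ?_
    rcases le_total (unop j₁.left) (unop j₂.left) with h | h
    · exact .inr ⟨CostructuredArrow.homMk (homOfLE h).op rfl⟩
    · exact .inl ⟨CostructuredArrow.homMk (homOfLE h).op rfl⟩

/-- Local cohomology can be computed using powers of generators of the ideal. -/
lemma nonempty_iso_listPowersDiagram (rs : List R) (i : ℕ) :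
    Nonempty (ofDiagram.{u, 0} (listPowersDiagram rs) i ≅
      localCohomology (Ideal.ofList rs) i) := by
  let I := Ideal.ofList rs
  have hI : I.FG := Submodule.fg_span rs.finite_toSet
  let D : ℕᵒᵖ ⥤ SelfLERadical I := ObjectProperty.lift _ (listPowersDiagram rs)
    fun k ↦ ofList_le_radical_ofList_map_pow rs k.unop
  have hpow (K : SelfLERadical I) : ∃ k : ℕ, I ^ k ≤ K.obj :=
    Ideal.exists_pow_le_of_le_radical_of_fg K.2 hI
  have := initial_of_forall_exists_le (idealPowersToSelfLERadical I) hpow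
  have := initial_of_forall_exists_le D fun K ↦
    (hpow K).imp fun k hk ↦ (ofList_map_pow_le_pow rs k).trans hk
  exact ⟨HasColimit.isoOfNatIso.{0, 0, u + 1, u + 1} (Iso.refl _) ≪≫
    isoOfFinal.{u, u, 0} D (selfLERadicalDiagram.{u} I) i ≪≫
    (isoOfFinal.{u, u, 0} (idealPowersToSelfLERadical I) (selfLERadicalDiagram.{u} I) i).symm ≪≫
    HasColimit.isoOfNatIso.{0, 0, u + 1, u + 1} (Iso.refl _)⟩

/-- If `I` is generated by a weakly regular sequence, then local cohomology with support in `I`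
commutes with filtered colimits. -/
lemma isElementwiseColimit_mapCocone {rs : List R}
    (hrs : RingTheory.Sequence.IsWeaklyRegular R rs) (i : ℕ)
    {J : Type*} [Category J] [IsFiltered J] {L : J ⥤ ModuleCat.{u} R} {c : Cocone L}
    (hc : ModuleCat.IsElementwiseColimit c) :
    ModuleCat.IsElementwiseColimit ((localCohomology (Ideal.ofList rs) i).mapCocone c) := by
  obtain ⟨e⟩ := nonempty_iso_listPowersDiagram rs i
  have : PreservesFilteredColimitsOfSize.{0, 0} (forget (ModuleCat.{u} R)) :=
    preservesFilteredColimitsOfSize_shrink.{0, u, 0, u} _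
  refine .mapCocone_of_natIso e (.mapCocone_colimit (diagram (listPowersDiagram rs) i) fun k ↦ ?_)
  have : Module.IsFPInfinity R (R ⧸ (listPowersDiagram rs).obj k.unop) := by
    have h := (Module.IsFPInfinity.of_free (M := R)).quotient_ofList_smul_top
      (hrs.map_pow k.unop.unop)
    rwa [smul_eq_mul, Ideal.mul_top] at h
  exact this.isElementwiseColimit_mapCocone_ext i hc

end localCohomology

/-- For a regular sequence `α_0, …, α_n` of non-zero-divisors generating `I`,
each local cohomology functor `H_I^i` commutes with filtered colimits: the canonical map
`colimⱼ H_I^i(F(j)) → H_I^i(colimⱼ F(j))` is an isomorphism. -/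
theorem stmt17 {R : Type u} [CommRing R] (n : ℕ) (α : Fin (n + 1) → R)
    (hreg : RingTheory.Sequence.IsWeaklyRegular R (List.ofFn α))
    (hnzd : ∀ i, α i ∈ nonZeroDivisors R) (i : ℕ)
    (J : Type u) [SmallCategory J] [IsFiltered J] (F : J ⥤ ModuleCat.{u} R) :
    IsIso (colimit.post F (localCohomology (Ideal.span (Set.range α)) i)) := by
  have hI : Ideal.span (Set.range α) = Ideal.ofList (List.ofFn α) := by
    simp only [Ideal.ofList, List.mem_ofFn', Set.ofPred_mem_eq]
  rw [hI]
  have := (localCohomology.isElementwiseColimit_mapCocone hreg i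
    (.of_isColimit (colimit.isColimit F))).nonempty_isColimit
  have : PreservesColimit F (localCohomology (Ideal.ofList (List.ofFn α)) i) :=
    preservesColimit_of_preserves_colimit_cocone (colimit.isColimit F) this.some
  infer_instance
end

section
/- Let p be a prime, A = ℤ_(p) the localization of ℤ at the prime ideal (p), and R = A[v_1, v_2, v_3, …] the polynomial ring over A on countably many variables; set v_0 = p, and for m ≥ 0 let I_m denote the ideal (v_0, v_1, …, v_{m−1}) of R (so I_0 = 0). Fix n ≥ 0 and 0 ≤ k ≤ n. Then the local cohomology H_{I_{n+1}}^i(R/I_k) vanishes for every i ≠ n + 1 − k, and H_{I_{n+1}}^{n+1−k}(R/I_k) is isomorphic to the colimit over j ≥ 1 of the R-modules R/(v_0, …, v_{k−1}, v_k^j, v_{k+1}^j, …, v_n^j), where the transition map from stage j to stage j+1 is induced by multiplication by v_k v_{k+1} ⋯ v_n. -/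
open CategoryTheory

theorem span_p_isPrime (p : ℕ) (hp : p.Prime) : (Ideal.span {(p : ℤ)}).IsPrime :=
  (Ideal.span_singleton_prime (by exact_mod_cast hp.ne_zero)).mpr
    (Nat.prime_iff_prime_int.mp hp)

/-- `ℤ_(p)`, the localization of `ℤ` at the prime ideal `(p)`. -/
abbrev ZLoc (p : ℕ) (hp : p.Prime) : Type :=
  haveI := span_p_isPrime p hp
  Localization.AtPrime (Ideal.span {(p : ℤ)})

/-- `R = ℤ_(p)[v_1, v_2, v_3, …]`, the polynomial ring on countably many variables. -/
abbrev BPRing (p : ℕ) (hp : p.Prime) : Type := MvPolynomial ℕ (ZLoc p hp)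

/-- The elements `v_0 = p` and `v_{m+1} = X_m` of `R`. -/
noncomputable def vGen (p : ℕ) (hp : p.Prime) : ℕ → BPRing p hp
  | 0 => (p : BPRing p hp)
  | (m + 1) => MvPolynomial.X m

/-- The invariant ideal `I_m = (v_0, …, v_{m-1})`. -/
noncomputable def Iideal (p : ℕ) (hp : p.Prime) (m : ℕ) : Ideal (BPRing p hp) :=
  Ideal.span (vGen p hp '' Set.Iio m)

/-- The ideal `(v_0, …, v_{k-1}, v_k^{j+1}, …, v_n^{j+1})`, the `j`-th stage of the tower
whose colimit is `R/(v_0, …, v_{k-1}, v_k^∞, …, v_n^∞)`. -/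
noncomputable def Jideal (p : ℕ) (hp : p.Prime) (k n j : ℕ) : Ideal (BPRing p hp) :=
  Ideal.span ((vGen p hp '' Set.Iio k) ∪ ((fun i => vGen p hp i ^ (j + 1)) '' Set.Icc k n))

theorem Jideal_le_comap (p : ℕ) (hp : p.Prime) (k n : ℕ) (hk : k ≤ n) (j j' : ℕ)
    (h : j ≤ j') :
    (Jideal p hp k n j : Submodule (BPRing p hp) (BPRing p hp)) ≤
      Submodule.comap
        (LinearMap.lsmul (BPRing p hp) (BPRing p hp)
          ((∏ i ∈ Finset.Icc k n, vGen p hp i) ^ (j' - j)))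
        (Jideal p hp k n j' : Submodule (BPRing p hp) (BPRing p hp)) := by
  intro x hx
  rw [Submodule.mem_comap, LinearMap.lsmul_apply, smul_eq_mul]
  refine Submodule.span_induction ?_ ?_ ?_ ?_ hx
  · rintro g (⟨i, hi, rfl⟩ | ⟨i, hi, rfl⟩)
    · exact Ideal.mul_mem_left _ _ (Ideal.subset_span (Or.inl ⟨i, hi, rfl⟩))
    · have hmem : vGen p hp i ^ (j' + 1) ∈ Jideal p hp k n j' :=
        Ideal.subset_span (Or.inr ⟨i, hi, rfl⟩)
      have hsplit : ∏ l ∈ Finset.Icc k n, vGen p hp l =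
          vGen p hp i * ∏ l ∈ (Finset.Icc k n).erase i, vGen p hp l := by
        rw [Finset.mul_prod_erase _ _ (by
          simp only [Finset.mem_Icc]
          exact ⟨hi.1, hi.2⟩)]
      have key : (∏ l ∈ Finset.Icc k n, vGen p hp l) ^ (j' - j) * (vGen p hp i ^ (j + 1)) =
          (∏ l ∈ (Finset.Icc k n).erase i, vGen p hp l) ^ (j' - j) *
            vGen p hp i ^ (j' + 1) := by
        rw [hsplit, mul_pow]
        have hjj : j' + 1 = j' - j + (j + 1) := by omega
        rw [hjj, pow_add]
        ring
      dsimp only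
      rw [key]
      exact Ideal.mul_mem_left _ _ hmem
  · rw [mul_zero]; exact Submodule.zero_mem _
  · intro a b _ _ ha hb
    rw [mul_add]; exact Submodule.add_mem _ ha hb
  · intro r a _ ha
    rw [smul_eq_mul, mul_left_comm]
    exact Ideal.mul_mem_left _ _ ha

/-- The transition maps of the tower `R/(v_0, …, v_{k-1}, v_k^{j+1}, …, v_n^{j+1})`, induced by
multiplication by `(v_k ⋯ v_n)^{j' - j}` (one factor of `v_k ⋯ v_n` for each step). -/
noncomputable def towerMap (p : ℕ) (hp : p.Prime) (k n : ℕ) (hk : k ≤ n) :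
    ∀ j j' : ℕ, j ≤ j' →
      (BPRing p hp ⧸ Jideal p hp k n j) →ₗ[BPRing p hp]
        (BPRing p hp ⧸ Jideal p hp k n j') :=
  fun j j' h => Submodule.mapQ _ _
    (LinearMap.lsmul (BPRing p hp) (BPRing p hp)
      ((∏ i ∈ Finset.Icc k n, vGen p hp i) ^ (j' - j)))
    (Jideal_le_comap p hp k n hk j j' h)

section

universe u

variable {R : Type u} [CommRing R]

theorem CategoryTheory.Iso.comp_inv_eq_inv_comp {V : Type*} [Category* V] {a b a' b' : V}
    (e : a ≅ b)
    (e' : a' ≅ b') {f : a ⟶ a'} {g : b ⟶ b'} (h : e.hom ≫ g = f ≫ e'.hom) :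
    g ≫ e'.inv = e.inv ≫ f := by
  rw [Iso.comp_inv_eq, Category.assoc, ← h, Iso.inv_hom_id_assoc]

theorem HomologicalComplex.homologyUnop_inv_naturality {ι V : Type*} [Category* V]
    [Abelian V] {c : ComplexShape ι}
    {K L : HomologicalComplex Vᵒᵖ c} (φ : K ⟶ L) (i : ι) :
    (HomologicalComplex.homologyMap φ i).unop ≫ (K.homologyUnop i).inv =
      (L.homologyUnop i).inv ≫
        HomologicalComplex.homologyMap ((HomologicalComplex.unopFunctor _ _).map φ.op) i := by
  have h := HomologicalComplex.homologyOp_hom_naturality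
    ((HomologicalComplex.unopFunctor _ _).map φ.op) i
  exact CategoryTheory.Iso.comp_inv_eq_inv_comp (L.homologyUnop i) (K.homologyUnop i)
    (congrArg Quiver.Hom.unop h)

theorem CategoryTheory.comp_squares {V : Type*} [Category* V] {a b c a' b' c' : V}
    {f : a ⟶ b} {g : b ⟶ c} {f' : a' ⟶ b'} {g' : b' ⟶ c'} {s : a ⟶ a'} {t : b ⟶ b'} {r : c ⟶ c'}
    (h : s ≫ f' = f ≫ t) (h' : t ≫ g' = g ≫ r) : s ≫ f' ≫ g' = (f ≫ g) ≫ r := by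
  rw [Category.assoc, ← h', ← Category.assoc, ← Category.assoc, h]

namespace CategoryTheory.ProjectiveResolution
variable {C : Type*} [Category* C] [Abelian C] [Linear R C] [EnoughProjectives C] {X X' : C}

/-- The map `Hom(P, Y) ⟶ Hom(Q, Y)` induced by a map `Q ⟶ P` between resolutions. -/
noncomputable def homMap {P' : ProjectiveResolution X'} {P : ProjectiveResolution X}
    (φ : P'.complex ⟶ P.complex) (Y : C) :
    P.complex.linearYonedaObj R Y ⟶ P'.complex.linearYonedaObj R Y :=
  (HomologicalComplex.unopFunctor _ _).map
    (((((linearYoneda R C).obj Y).rightOp.mapHomologicalComplex _).map φ).op)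

theorem isoExt_naturality (g : X' ⟶ X) (P' : ProjectiveResolution X')
    (P : ProjectiveResolution X) (φ : P'.complex ⟶ P.complex)
    (comm : φ.f 0 ≫ P.π.f 0 = P'.π.f 0 ≫ g) (n : ℕ) (Y : C) :
    ((Ext R C n).map g.op).app Y ≫ (P'.isoExt n Y).hom =
      (P.isoExt n Y).hom ≫ HomologicalComplex.homologyMap (homMap φ Y) n :=
  comp_squares
    (congrArg Quiver.Hom.unop (isoLeftDerivedObj_inv_naturality g P' P φ comm
      ((linearYoneda R C).obj Y).rightOp n))
    (HomologicalComplex.homologyUnop_inv_naturality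
      ((((linearYoneda R C).obj Y).rightOp.mapHomologicalComplex (ComplexShape.down ℕ)).map φ) n)

end CategoryTheory.ProjectiveResolution

namespace CochainComplex
variable (K L : CochainComplex (ModuleCat.{u} R) ℕ) (n : ℕ)

/-- The class map from cocycles, given as a kernel, to cohomology. -/
noncomputable def cocycleClass : LinearMap.ker (K.d n (n + 1)).hom →ₗ[R] K.homology n :=
  (K.liftCycles (A := ModuleCat.of R (LinearMap.ker (K.d n (n + 1)).hom))
    (ModuleCat.ofHom (Submodule.subtype _)) (n + 1) (by simp) (by ext x; exact x.2) ≫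
      K.homologyπ n).hom

theorem cocycleClass_surjective : Function.Surjective (cocycleClass K n) := by
  intro y
  obtain ⟨z, rfl⟩ := (ModuleCat.epi_iff_surjective (K.homologyπ n)).1 inferInstance y
  refine ⟨⟨(K.iCycles n).hom z, ?_⟩, ?_⟩
  · have := congrArg (fun f => f.hom z) (K.iCycles_d n (n + 1))
    exact this
  · refine congrArg (K.homologyπ n).hom ?_
    apply (ModuleCat.mono_iff_injective (K.iCycles n)).1 inferInstance
    exact DFunLike.congr_fun (congrArg ModuleCat.Hom.hom
      (K.liftCycles_i (A := ModuleCat.of R (LinearMap.ker (K.d n (n + 1)).hom))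
        (ModuleCat.ofHom (Submodule.subtype _)) (n + 1) (by simp) (by ext x; exact x.2))) _

theorem homologyπ_eq_zero_iff (z : K.cycles n) : (K.homologyπ n).hom z = 0 ↔
    ∃ y, (K.d ((ComplexShape.up ℕ).prev n) n).hom y = (K.iCycles n).hom z := by
  have hex : (ShortComplex.mk (K.toCycles ((ComplexShape.up ℕ).prev n) n) (K.homologyπ n)
      (K.toCycles_comp_homologyπ _ n)).Exact :=
    ShortComplex.exact_of_g_is_cokernel _
      (K.homologyIsCokernel ((ComplexShape.up ℕ).prev n) n (by simp))
  rw [ShortComplex.moduleCat_exact_iff_range_eq_ker] at hex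
  have h := congrArg (fun f => z ∈ f) hex
  simp only [LinearMap.mem_range, LinearMap.mem_ker, eq_iff_iff] at h
  refine h.symm.trans (exists_congr fun y => ?_)
  rw [← (((ModuleCat.mono_iff_injective (K.iCycles n)).1 inferInstance).eq_iff)]
  have := congrArg (fun f => f.hom y) (K.toCycles_i ((ComplexShape.up ℕ).prev n) n)
  rw [← this]
  rfl

theorem cocycleClass_eq_zero_iff (x) : cocycleClass K n x = 0 ↔
    ∃ y, (K.d ((ComplexShape.up ℕ).prev n) n).hom y = x.1 := by
  refine (homologyπ_eq_zero_iff K n _).trans (exists_congr fun y => ?_)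
  have := congrArg (fun f => f.hom x) (K.liftCycles_i
    (A := ModuleCat.of R (LinearMap.ker (K.d n (n + 1)).hom)) (ModuleCat.ofHom (Submodule.subtype _))
    (n + 1) (by simp) (by ext x; exact x.2))
  refine Eq.congr rfl this

theorem homologyMap_cocycleClass {K L : CochainComplex (ModuleCat.{u} R) ℕ} (φ : K ⟶ L)
    (x) (x') (h : (φ.f n).hom x.1 = x'.1) :
    (HomologicalComplex.homologyMap φ n).hom (cocycleClass K n x) = cocycleClass L n x' := by
  refine (DFunLike.congr_fun (congrArg ModuleCat.Hom.hom
    (HomologicalComplex.homologyπ_naturality φ n)) _).trans ?_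
  refine congrArg (L.homologyπ n).hom ?_
  apply (ModuleCat.mono_iff_injective (L.iCycles n)).1 inferInstance
  refine (DFunLike.congr_fun (congrArg ModuleCat.Hom.hom
    (HomologicalComplex.cyclesMap_i φ n)) _).trans ?_
  refine Eq.trans ?_ (congrArg (fun f => f.hom x')
    (L.liftCycles_i (A := ModuleCat.of R (LinearMap.ker (L.d n (n + 1)).hom))
    (ModuleCat.ofHom (Submodule.subtype _)) (n + 1) (by simp) (by ext x; exact x.2))).symm
  refine Eq.trans ?_ h
  refine congrArg (φ.f n).hom ?_
  exact (congrArg (fun f => f.hom x) (K.liftCycles_i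
    (A := ModuleCat.of R (LinearMap.ker (K.d n (n + 1)).hom)) (ModuleCat.ofHom (Submodule.subtype _))
    (n + 1) (by simp) (by ext x; exact x.2)))
end CochainComplex

theorem LinearMap.exists_linearEquiv_of_ker_eq {M A B : Type*} [AddCommGroup M] [AddCommGroup A]
    [AddCommGroup B] [Module R M] [Module R A] [Module R B] (f : M →ₗ[R] A) (g : M →ₗ[R] B)
    (hf : Function.Surjective f) (hg : Function.Surjective g) (h : ∀ z, f z = 0 ↔ g z = 0) :
    ∃ e : A ≃ₗ[R] B, ∀ z, e (f z) = g z := by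
  have hk : LinearMap.ker f = LinearMap.ker g := by ext z; simpa using h z
  refine ⟨(f.quotKerEquivOfSurjective hf).symm ≪≫ₗ Submodule.quotEquivOfEq _ _ hk ≪≫ₗ
    g.quotKerEquivOfSurjective hg, fun z => ?_⟩
  have : (f.quotKerEquivOfSurjective hf).symm (f z) = Submodule.Quotient.mk z := by
    rw [LinearEquiv.symm_apply_eq]; rfl
  simp only [LinearEquiv.trans_apply, this]
  rfl

namespace CategoryTheory.ProjectiveResolution
variable {X Y : ModuleCat.{u} R} (P : ProjectiveResolution X) (n : ℕ)

theorem linearYonedaObj_d_apply (i j : ℕ) (f : P.complex.X i ⟶ Y) :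
    ((P.complex.linearYonedaObj R Y).d i j).hom f = P.complex.d j i ≫ f := rfl

variable (Y) in
/-- Cocycles of degree `n` in `Hom(P, Y)`. -/
abbrev homCocycles : Submodule R ((P.complex.linearYonedaObj R Y).X n) :=
  LinearMap.ker ((P.complex.linearYonedaObj R Y).d n (n + 1)).hom

/-- The class of a cocycle in the derived-functor `Ext`. -/
noncomputable def derivedExtMk :
    P.homCocycles Y n →ₗ[R] ((_root_.Ext R (ModuleCat.{u} R) n).obj (Opposite.op X)).obj Y :=
  (P.isoExt n Y).inv.hom ∘ₗ CochainComplex.cocycleClass (P.complex.linearYonedaObj R Y) n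

theorem derivedExtMk_surjective : Function.Surjective (P.derivedExtMk (Y := Y) n) :=
  (P.isoExt n Y).symm.toLinearEquiv.surjective.comp
    (CochainComplex.cocycleClass_surjective _ n)

theorem derivedExtMk_eq_zero_iff (x : P.homCocycles Y n) : P.derivedExtMk n x = 0 ↔
    ∃ y, ((P.complex.linearYonedaObj R Y).d ((ComplexShape.up ℕ).prev n) n).hom y = x.1 := by
  rw [← CochainComplex.cocycleClass_eq_zero_iff]
  exact (P.isoExt n Y).symm.toLinearEquiv.injective.eq_iff'
    (map_zero (P.isoExt n Y).inv.hom)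

theorem isoExt_hom_derivedExtMk (z : P.homCocycles Y n) :
    (P.isoExt n Y).hom.hom (P.derivedExtMk n z) =
      CochainComplex.cocycleClass (P.complex.linearYonedaObj R Y) n z :=
  (P.isoExt n Y).toLinearEquiv.apply_symm_apply _

/-- The class of a cocycle in the derived-category `Ext`. -/
noncomputable def abelianExtMk : P.homCocycles Y n →ₗ[R] Abelian.Ext X Y n where
  toFun f := P.extMk f.1 (n + 1) rfl f.2
  map_add' f g := (P.add_extMk _ _ _ _ _ _).symm
  map_smul' r f := by
    rw [Abelian.Ext.smul_eq_comp_mk₀, RingHom.id_apply]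
    refine Eq.trans ?_ (P.extMk_comp_mk₀ (n := n) f.1 (n + 1) rfl f.2 _).symm
    congr 1

theorem abelianExtMk_surjective : Function.Surjective (P.abelianExtMk (Y := Y) n) := fun α => by
  obtain ⟨f, hf, h⟩ := P.extMk_surjective α (n + 1) rfl
  exact ⟨⟨f, hf⟩, h⟩

theorem extMk_zero_eq_zero_iff (f : P.complex.X 0 ⟶ Y) (m : ℕ) (hm : 0 + 1 = m)
    (hf : P.complex.d m 0 ≫ f = 0) : P.extMk f m hm hf = 0 ↔ f = 0 := by
  refine ⟨fun h => ?_, ?_⟩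
  · rw [← P.extEquivCohomologyClass.apply_eq_iff_eq, extEquivCohomologyClass_extMk,
      extEquivCohomologyClass_zero, CochainComplex.HomComplex.CohomologyClass.mk_eq_zero_iff,
      CochainComplex.HomComplex.Cocycle.toSingleMk_mem_coboundaries_iff _ _ _ _ _ 1 (by simp)] at h
    obtain ⟨g, hg⟩ := h
    have h0 : P.cochainComplex.d (-(0 : ℕ)) 1 = 0 := by
      exact (CochainComplex.isZero_of_isStrictlyLE P.cochainComplex 0 1 (by simp)).eq_of_tgt _ _
    rw [h0, Limits.zero_comp] at hg
    rw [← cancel_epi (P.cochainComplexXIso (-(0 : ℕ)) 0 rfl).hom, ← hg, Limits.comp_zero]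
  · rintro rfl
    exact P.extMk_zero _ _

theorem abelianExtMk_eq_zero_iff (x : P.homCocycles Y n) : P.abelianExtMk n x = 0 ↔
    ∃ y, ((P.complex.linearYonedaObj R Y).d ((ComplexShape.up ℕ).prev n) n).hom y = x.1 := by
  cases n with
  | zero =>
    refine (P.extMk_zero_eq_zero_iff x.1 _ rfl x.2).trans ⟨fun h => ⟨0, ?_⟩, ?_⟩
    · rw [h]; exact map_zero _
    · rintro ⟨y, hy⟩
      exact hy.symm.trans (DFunLike.congr_fun (congrArg ModuleCat.Hom.hom
        ((P.complex.linearYonedaObj R Y).shape ((ComplexShape.up ℕ).prev 0) 0 (by simp))) y)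
  | succ n =>
    rw [CochainComplex.prev_nat_succ]
    exact P.extMk_eq_zero_iff x.1 _ rfl x.2 n rfl

theorem exists_extEquiv :
    ∃ e : ((_root_.Ext R (ModuleCat.{u} R) n).obj (Opposite.op X)).obj Y ≃ₗ[R]
    Abelian.Ext X Y n, ∀ z, e (P.derivedExtMk n z) = P.abelianExtMk n z :=
  LinearMap.exists_linearEquiv_of_ker_eq _ _ (P.derivedExtMk_surjective n)
    (P.abelianExtMk_surjective n) fun z =>
      (P.derivedExtMk_eq_zero_iff n z).trans (P.abelianExtMk_eq_zero_iff n z).symm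

end CategoryTheory.ProjectiveResolution

/-- The comparison between the derived-functor and the derived-category `Ext`. -/
noncomputable def ModuleCat.extEquiv (X Y : ModuleCat.{u} R) (n : ℕ) :
    ((_root_.Ext R (ModuleCat.{u} R) n).obj (Opposite.op X)).obj Y ≃ₗ[R] Abelian.Ext X Y n :=
  ((CategoryTheory.projectiveResolution X).exists_extEquiv n).choose

theorem ModuleCat.extEquiv_naturality {X X' : ModuleCat.{u} R} (g : X' ⟶ X) (Y : ModuleCat.{u} R)
    (n : ℕ) (x : ((_root_.Ext R (ModuleCat.{u} R) n).obj (Opposite.op X)).obj Y) :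
    extEquiv X' Y n ((((_root_.Ext R (ModuleCat.{u} R) n).map g.op).app Y).hom x) =
      (Abelian.Ext.mk₀ g).comp (extEquiv X Y n x) (zero_add n) := by
  set P := CategoryTheory.projectiveResolution X
  set P' := CategoryTheory.projectiveResolution X'
  obtain ⟨z, rfl⟩ := P.derivedExtMk_surjective n x
  let φ : P'.complex ⟶ P.complex := ProjectiveResolution.lift g P' P
  have hφ : φ.f 0 ≫ P.π.f 0 = P'.π.f 0 ≫ g := ProjectiveResolution.lift_commutes_zero g P' P
  let φ' : ProjectiveResolution.Hom P' P g := ⟨φ, by simpa using hφ⟩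
  let z' : P'.homCocycles Y n := ⟨φ.f n ≫ (z.1 : P.complex.X n ⟶ Y), by
    have hz : P.complex.d (n + 1) n ≫ (z.1 : P.complex.X n ⟶ Y) = 0 := z.2
    change P'.complex.d (n + 1) n ≫ φ.f n ≫ (z.1 : P.complex.X n ⟶ Y) = 0
    refine (φ.comm_assoc _ _ _).symm.trans ?_
    exact (congrArg (φ.f (n + 1) ≫ ·) hz).trans Limits.comp_zero⟩
  have h1 : (((_root_.Ext R (ModuleCat.{u} R) n).map g.op).app Y).hom (P.derivedExtMk n z) =
      P'.derivedExtMk n z' := by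
    have h := ProjectiveResolution.isoExt_naturality (R := R) g P' P φ hφ n Y
    have h2 := DFunLike.congr_fun (congrArg ModuleCat.Hom.hom h) (P.derivedExtMk n z)
    apply (P'.isoExt n Y).toLinearEquiv.injective
    refine h2.trans ?_
    refine (congrArg (HomologicalComplex.homologyMap
      (ProjectiveResolution.homMap φ Y) n).hom (P.isoExt_hom_derivedExtMk n z)).trans
        (Eq.trans ?_ (P'.isoExt_hom_derivedExtMk n z').symm)
    exact CochainComplex.homologyMap_cocycleClass n _ _ _ rfl
  rw [h1]
  refine ((P'.exists_extEquiv n).choose_spec z').trans ?_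
  rw [show extEquiv X Y n (P.derivedExtMk n z) = _ from (P.exists_extEquiv n).choose_spec z]
  exact (ProjectiveResolution.mk₀_comp_extMk (n := n) (Y := Y) z.1 (n + 1) rfl z.2 φ').symm

namespace Ideal

/-- The quotient `R ⧸ I` as an object of the category of modules. -/
abbrev quotientModuleCat (I : Ideal R) : ModuleCat.{u} R := ModuleCat.of R (R ⧸ I)

/-- The canonical map `R ⧸ I ⟶ R ⧸ J` for `I ≤ J`. -/
abbrev factorHom {I J : Ideal R} (h : I ≤ J) : I.quotientModuleCat ⟶ J.quotientModuleCat :=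
  ModuleCat.ofHom (Submodule.mapQ I J LinearMap.id h)

theorem factorHom_comp {I J K : Ideal R} (h : I ≤ J) (h' : J ≤ K) :
    factorHom h ≫ factorHom h' = factorHom (h.trans h') := by
  ext : 1
  refine LinearMap.ext fun x => ?_
  obtain ⟨x, rfl⟩ := Ideal.Quotient.mk_surjective x
  rfl

theorem factorHom_refl (I : Ideal R) : factorHom (le_refl I) = 𝟙 _ := by
  ext : 1
  refine LinearMap.ext fun x => ?_
  obtain ⟨x, rfl⟩ := Ideal.Quotient.mk_surjective x
  rfl

/-- Restriction `Ext^i(R/J, M) → Ext^i(R/I, M)` along `I ≤ J`. -/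
noncomputable def extRes {I J : Ideal R} (h : I ≤ J) (M : ModuleCat.{u} R) (i : ℕ) :
    Abelian.Ext J.quotientModuleCat M i →ₗ[R] Abelian.Ext I.quotientModuleCat M i where
  toFun x := (Abelian.Ext.mk₀ (factorHom h)).comp x (zero_add i)
  map_add' _ _ := Abelian.Ext.comp_add _ _ _ _
  map_smul' _ _ := Abelian.Ext.comp_smul _ _ _ _

theorem extRes_extRes {I J K : Ideal R} (h : I ≤ J) (h' : J ≤ K) (M : ModuleCat.{u} R) (i : ℕ)
    (x : Abelian.Ext K.quotientModuleCat M i) :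
    extRes h M i (extRes h' M i x) = extRes (h.trans h') M i x := by
  simp only [extRes, LinearMap.coe_mk, AddHom.coe_mk]
  rw [Abelian.Ext.mk₀_comp_mk₀_assoc, factorHom_comp]

theorem extRes_refl (I : Ideal R) (M : ModuleCat.{u} R) (i : ℕ)
    (x : Abelian.Ext I.quotientModuleCat M i) : extRes (le_refl I) M i x = x := by
  simp only [extRes, LinearMap.coe_mk, AddHom.coe_mk]
  rw [factorHom_refl, Abelian.Ext.mk₀_id_comp]

theorem mk₀_smul_id_comp {X M : ModuleCat.{u} R} {i : ℕ} (r : R) (x : Abelian.Ext X M i) :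
    (Abelian.Ext.mk₀ (r • 𝟙 X)).comp x (zero_add i) = r • x := by
  rw [Abelian.Ext.mk₀_smul, Abelian.Ext.smul_comp, Abelian.Ext.mk₀_id_comp]

/-- The sequence `R/K → R/K → R/(K + (r))` whose first map is multiplication by `r`. -/
noncomputable def mulShortComplex (K : Ideal R) (r : R) : ShortComplex (ModuleCat.{u} R) where
  X₁ := K.quotientModuleCat
  X₂ := K.quotientModuleCat
  X₃ := (K ⊔ Ideal.span {r}).quotientModuleCat
  f := r • 𝟙 _
  g := factorHom le_sup_left
  zero := by
    ext : 1
    refine LinearMap.ext fun x => ?_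
    obtain ⟨x, rfl⟩ := Ideal.Quotient.mk_surjective x
    refine Ideal.Quotient.eq_zero_iff_mem.2 (Ideal.mem_sup_right ?_ : r * x ∈ K ⊔ Ideal.span {r})
    exact Ideal.mul_mem_right _ _ (Ideal.mem_span_singleton_self r)

theorem mulShortComplex_shortExact {K : Ideal R} {r : R} (hr : ∀ f, r * f ∈ K → f ∈ K) :
    (mulShortComplex K r).ShortExact := by
  refine ModuleCat.shortComplex_shortExact _ ?_ ?_ ?_
  · intro y
    obtain ⟨y, rfl⟩ := Ideal.Quotient.mk_surjective y
    constructor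
    · intro h
      have h' : y ∈ K ⊔ Ideal.span {r} := Ideal.Quotient.eq_zero_iff_mem.1 h
      obtain ⟨a, ha, b, hb, rfl⟩ := Submodule.mem_sup.1 h'
      obtain ⟨c, rfl⟩ := Ideal.mem_span_singleton'.1 hb
      refine ⟨(Ideal.Quotient.mk K c : R ⧸ K), ?_⟩
      refine Ideal.Quotient.eq.2 (?_ : r * c - (a + c * r) ∈ K)
      convert K.neg_mem ha using 1
      ring
    · rintro ⟨x, hx⟩
      rw [← hx]
      exact DFunLike.congr_fun (congrArg ModuleCat.Hom.hom (mulShortComplex K r).zero) x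
  · refine (injective_iff_map_eq_zero (mulShortComplex K r).f.hom).2 fun x hx => ?_
    obtain ⟨x, rfl⟩ := Ideal.Quotient.mk_surjective x
    exact Ideal.Quotient.eq_zero_iff_mem.2 (hr x (Ideal.Quotient.eq_zero_iff_mem.1 hx))
  · intro x
    obtain ⟨x, rfl⟩ := Ideal.Quotient.mk_surjective x
    exact ⟨(Ideal.Quotient.mk K x : R ⧸ K), rfl⟩

/-- The connecting map `Ext^i(R/K, M) → Ext^{i+1}(R/(K + (r)), M)` for `r` regular on `R/K`. -/
noncomputable def extδ {K : Ideal R} {r : R} (hr : ∀ f, r * f ∈ K → f ∈ K)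
    (M : ModuleCat.{u} R) (i : ℕ) : Abelian.Ext K.quotientModuleCat M i →ₗ[R]
      Abelian.Ext (K ⊔ Ideal.span {r}).quotientModuleCat M (i + 1) where
  toFun x := (mulShortComplex_shortExact hr).extClass.comp x (add_comm 1 i)
  map_add' _ _ := Abelian.Ext.comp_add _ _ _ _
  map_smul' _ _ := Abelian.Ext.comp_smul _ _ _ _

section
variable {K : Ideal R} {r : R} (hr : ∀ f, r * f ∈ K → f ∈ K) (M : ModuleCat.{u} R) (i : ℕ)

theorem extδ_eq_zero_iff (x) : extδ hr M i x = 0 ↔ ∃ y, r • y = x := by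
  constructor
  · intro h
    obtain ⟨y, hy⟩ := Abelian.Ext.contravariant_sequence_exact₁ (mulShortComplex_shortExact hr) M
      x (add_comm 1 i) h
    exact ⟨y, (mk₀_smul_id_comp r y).symm.trans hy⟩
  · rintro ⟨y, rfl⟩
    have h := (mulShortComplex_shortExact hr).extClass_comp_assoc (Y := M) y (h := add_comm 1 i)
    rw [← mk₀_smul_id_comp]
    exact h

theorem exists_extRes_eq {K : Ideal R} {r : R} (hr : ∀ f, r * f ∈ K → f ∈ K)
    (M : ModuleCat.{u} R) (i : ℕ) (x : Abelian.Ext K.quotientModuleCat M i) (hx : r • x = 0) :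
    ∃ y, extRes (le_sup_left : K ≤ K ⊔ Ideal.span {r}) M i y = x :=
  Abelian.Ext.contravariant_sequence_exact₂ (mulShortComplex_shortExact hr) M x
    ((mk₀_smul_id_comp r x).trans hx)

theorem smul_extRes (x) : r • extRes (le_sup_left : K ≤ K ⊔ Ideal.span {r}) M i x = 0 := by
  rw [← mk₀_smul_id_comp]
  simp only [extRes, LinearMap.coe_mk, AddHom.coe_mk]
  have h := (mulShortComplex K r).zero
  rw [Abelian.Ext.mk₀_comp_mk₀_assoc,
    show (r • 𝟙 K.quotientModuleCat) ≫ factorHom le_sup_left = 0 from h,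
    Abelian.Ext.mk₀_zero, Abelian.Ext.zero_comp]

theorem extδ_surjective_of_extRes (x)
    (hx : extRes (le_sup_left : K ≤ K ⊔ Ideal.span {r}) M (i + 1) x = 0) :
    ∃ w, extδ hr M i w = x :=
  Abelian.Ext.contravariant_sequence_exact₃ (mulShortComplex_shortExact hr) M x hx (add_comm 1 i)

theorem extRes_zero_injective {I J : Ideal R} (h : I ≤ J) : Function.Injective (extRes h M 0) := by
  have : Epi (factorHom h) := (ModuleCat.epi_iff_surjective _).2 fun x => by
    obtain ⟨x, rfl⟩ := Ideal.Quotient.mk_surjective x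
    exact ⟨(Ideal.Quotient.mk I x : R ⧸ I), rfl⟩
  exact Abelian.Ext.precomp_mk₀_injective_of_epi M (factorHom h)

end

theorem extRes_extδ {K₁ K₂ : Ideal R} {r₁ r₂ s : R} (hr₁ : ∀ f, r₁ * f ∈ K₁ → f ∈ K₁)
    (hr₂ : ∀ f, r₂ * f ∈ K₂ → f ∈ K₂) (hs : r₂ = s * r₁) (h : K₂ ≤ K₁)
    (h' : K₂ ⊔ Ideal.span {r₂} ≤ K₁ ⊔ Ideal.span {r₁}) (M : ModuleCat.{u} R) (i : ℕ)
    (w : Abelian.Ext K₁.quotientModuleCat M i) :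
    extRes h' M (i + 1) (extδ hr₁ M i w) = extδ hr₂ M i (s • extRes h M i w) := by
  let φ : mulShortComplex K₂ r₂ ⟶ mulShortComplex K₁ r₁ :=
    { τ₁ := s • factorHom h
      τ₂ := factorHom h
      τ₃ := factorHom h'
      comm₁₂ := by
        subst hs
        ext : 1
        refine LinearMap.ext fun x => ?_
        obtain ⟨x, rfl⟩ := Ideal.Quotient.mk_surjective x
        refine congrArg (Ideal.Quotient.mk K₁) (?_ : r₁ * (s * x) = (s * r₁) * x)
        ring
      comm₂₃ := by
        ext : 1
        refine LinearMap.ext fun x => ?_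
        obtain ⟨x, rfl⟩ := Ideal.Quotient.mk_surjective x
        rfl }
  have hn := ShortComplex.ShortExact.extClass_naturality (mulShortComplex_shortExact hr₂)
    (mulShortComplex_shortExact hr₁) φ
  have h1 : extRes h' M (i + 1) (extδ hr₁ M i w) = ((Abelian.Ext.mk₀ φ.τ₃).comp
      (mulShortComplex_shortExact hr₁).extClass (zero_add 1)).comp w (add_comm 1 i) :=
    (Abelian.Ext.comp_assoc _ _ _ _ (add_comm 1 i) (by lia)).symm
  have h2 : extδ hr₂ M i (s • extRes h M i w) = ((mulShortComplex_shortExact hr₂).extClass.comp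
      (Abelian.Ext.mk₀ φ.τ₁) (add_zero 1)).comp w (add_comm 1 i) := by
    refine Eq.trans ?_ (Abelian.Ext.comp_assoc (mulShortComplex_shortExact hr₂).extClass
      (Abelian.Ext.mk₀ φ.τ₁) w (add_zero 1) (zero_add i) (by lia)).symm
    refine congrArg (fun z => (mulShortComplex_shortExact hr₂).extClass.comp z (add_comm 1 i)) ?_
    refine Eq.trans ?_ (congrArg (fun z => Abelian.Ext.comp z w (zero_add i))
      (Abelian.Ext.mk₀_smul s (factorHom h))).symm
    exact (Abelian.Ext.smul_comp _ _ _ _).symm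
  exact h1.trans ((congrArg (fun z => Abelian.Ext.comp z w (add_comm 1 i)) hn).symm.trans h2.symm)

theorem ext_smul_eq_zero {X M : ModuleCat.{u} R} {r : R} (hr : ∀ m : M, r • m = 0) {i : ℕ}
    (x : Abelian.Ext X M i) : r • x = 0 := by
  rw [Abelian.Ext.smul_eq_comp_mk₀, show r • 𝟙 M = 0 by ext m; exact hr m,
    Abelian.Ext.mk₀_zero, Abelian.Ext.comp_zero]

/-- The modules `Ext^i(R/K_j, M)` are concentrated in degree `c`, where they are the
`R/(I + K_j)`, the restriction maps being induced by multiplication by powers of `t`. -/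
structure IsExtTower (K : ℕ → Ideal R) (hK : Antitone K) (M : ModuleCat.{u} R) (I : Ideal R)
    (t : R) (c : ℕ) : Prop where
  eq_zero : ∀ i j, i ≠ c → ∀ x : Abelian.Ext (K j).quotientModuleCat M i, x = 0
  exists_map : ∃ Ψ : ∀ j, R →ₗ[R] Abelian.Ext (K j).quotientModuleCat M c,
    (∀ j, Function.Surjective (Ψ j)) ∧ (∀ j f, Ψ j f = 0 ↔ f ∈ I ⊔ K j) ∧
    ∀ j j' (h : j ≤ j') f, extRes (hK h) M c (Ψ j f) = Ψ j' (t ^ (j' - j) * f)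

theorem isExtTower_bot (I : Ideal R) :
    IsExtTower (fun _ => ⊥) antitone_const I.quotientModuleCat I 1 0 := by
  have hproj : Projective (⊥ : Ideal R).quotientModuleCat := by
    have : Module.Projective R (R ⧸ (⊥ : Ideal R)) :=
      Module.Projective.of_equiv (Submodule.quotEquivOfEqBot (⊥ : Ideal R) rfl).symm
    exact (IsProjective.iff_projective (R := R) (R ⧸ (⊥ : Ideal R))).1 this
  refine ⟨fun i j hi x => ?_, ?_⟩
  · obtain ⟨i, rfl⟩ := Nat.exists_eq_succ_of_ne_zero hi
    exact Abelian.Ext.eq_zero_of_projective x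
  · let φ : R →ₗ[R] ((⊥ : Ideal R).quotientModuleCat ⟶ I.quotientModuleCat) :=
      LinearMap.toSpanSingleton R _ (factorHom bot_le)
    let e : ((⊥ : Ideal R).quotientModuleCat ⟶ I.quotientModuleCat) ≃ₗ[R]
        Abelian.Ext (⊥ : Ideal R).quotientModuleCat I.quotientModuleCat 0 :=
      Abelian.Ext.linearEquiv₀.symm
    have hφ (f : R) (x : R) : (φ f).hom (Ideal.Quotient.mk ⊥ x) = Ideal.Quotient.mk I (f * x) := rfl
    refine ⟨fun _ => e.toLinearMap ∘ₗ φ, fun j => e.surjective.comp fun g => ?_, fun j f => ?_,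
      fun j j' h f => ?_⟩
    · obtain ⟨f, hf⟩ := Ideal.Quotient.mk_surjective (g.hom (Ideal.Quotient.mk ⊥ 1))
      refine ⟨f, ?_⟩
      ext : 1
      refine LinearMap.ext fun x => ?_
      obtain ⟨x, rfl⟩ := Ideal.Quotient.mk_surjective x
      have hx : (Ideal.Quotient.mk ⊥ x : R ⧸ (⊥ : Ideal R)) = x • Ideal.Quotient.mk ⊥ 1 :=
        congrArg (Ideal.Quotient.mk ⊥) (mul_one x).symm
      refine (hφ f x).trans (Eq.trans ?_ ((congrArg g.hom hx).trans (g.hom.map_smul x _)).symm)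
      rw [← hf]
      exact congrArg (Ideal.Quotient.mk I) (mul_comm f x)
    · rw [LinearMap.comp_apply, LinearEquiv.coe_coe, e.map_eq_zero_iff, sup_bot_eq]
      constructor
      · intro h
        have := (hφ f 1).symm.trans (congrArg (fun g => g.hom (Ideal.Quotient.mk ⊥ 1)) h)
        rw [mul_one] at this
        exact Ideal.Quotient.eq_zero_iff_mem.1 this
      · intro h
        ext : 1
        refine LinearMap.ext fun x => ?_
        obtain ⟨x, rfl⟩ := Ideal.Quotient.mk_surjective x
        exact (hφ f x).trans (Ideal.Quotient.eq_zero_iff_mem.2 (I.mul_mem_right x h))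
    · rw [one_pow, one_mul]
      exact extRes_refl _ _ _ _

section Step
variable {K K' : ℕ → Ideal R} {hK : Antitone K} {hK' : Antitone K'} {r : R}

theorem IsExtTower.step {M : ModuleCat.{u} R} {I : Ideal R} {t : R} {c : ℕ}
    (H : IsExtTower K hK M I t c) (hr : ∀ j f, r ^ (j + 1) * f ∈ K j → f ∈ K j)
    (hr' : ∀ j f, r ^ (j + 1) * f ∈ I ⊔ K j → f ∈ I ⊔ K j)
    (hKK' : K' = fun j => K j ⊔ Ideal.span {r ^ (j + 1)}) :
    IsExtTower K' hK' M I (r * t) (c + 1) := by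
  subst hKK'
  obtain ⟨h0, Ψ, hs, hk, hn⟩ := H
  refine ⟨fun i j hi x => ?_, fun j => extδ (hr j) M c ∘ₗ Ψ j, fun j => ?_, fun j f => ?_,
    fun j j' h f => ?_⟩
  · have hx : extRes (le_sup_left : K j ≤ K j ⊔ Ideal.span {r ^ (j + 1)}) M i x = 0 := by
      by_cases hic : i = c
      · subst hic
        have := smul_extRes M i x
        obtain ⟨f, hf⟩ := hs j (extRes le_sup_left M i x)
        rw [← hf, ← map_smul, hk] at this
        rw [← hf, hk]
        exact hr' _ _ this
      · exact h0 _ _ hic _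
    cases i with
    | zero => exact extRes_zero_injective M _ (hx.trans (map_zero _).symm)
    | succ i =>
      obtain ⟨w, rfl⟩ := extδ_surjective_of_extRes (hr j) M i x hx
      rw [h0 i j (by lia) w, map_zero]
  · refine Function.Surjective.comp (g := extδ (hr j) M c) (fun x => ?_) (hs j)
    exact extδ_surjective_of_extRes (hr j) M c x (h0 _ _ (by lia) _)
  · rw [LinearMap.comp_apply, extδ_eq_zero_iff, ← sup_assoc]
    constructor
    · rintro ⟨y, hy⟩
      obtain ⟨g, rfl⟩ := hs j y
      rw [← map_smul, ← sub_eq_zero, ← map_sub, hk] at hy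
      have : f = -(r ^ (j + 1) • g - f) + r ^ (j + 1) * g := by rw [smul_eq_mul]; ring
      rw [this]
      exact add_mem (Ideal.mem_sup_left (neg_mem hy))
        (Ideal.mem_sup_right (Ideal.mul_mem_right _ _ (Ideal.mem_span_singleton_self _)))
    · intro hf
      obtain ⟨a, ha, b, hb, rfl⟩ := Submodule.mem_sup.1 hf
      obtain ⟨g, rfl⟩ := Ideal.mem_span_singleton'.1 hb
      refine ⟨Ψ j g, ?_⟩
      rw [map_add, (hk j a).2 ha, zero_add, ← map_smul, smul_eq_mul, mul_comm]
  · have hrr : r ^ (j' + 1) = r ^ (j' - j) * r ^ (j + 1) := by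
      rw [← pow_add]; congr 1; lia
    refine (extRes_extδ (hr j) (hr j') hrr (hK h) (hK' h) M c (Ψ j f)).trans ?_
    rw [hn j j' h, ← map_smul, LinearMap.comp_apply, smul_eq_mul, mul_pow, mul_assoc]

/-- Restriction from `K` to `L` is an ind-isomorphism on the modules `Ext^i(R/K_j, M)`. -/
structure IsIndExtIso (K L : ℕ → Ideal R) (hK : Antitone K) (hLK : L ≤ K)
    (M : ModuleCat.{u} R) : Prop where
  exists_eq_zero : ∀ i j (y : Abelian.Ext (K j).quotientModuleCat M i),
    extRes (hLK j) M i y = 0 → ∃ (j' : ℕ) (h : j ≤ j'), extRes (hK h) M i y = 0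
  exists_eq : ∀ i j (z : Abelian.Ext (L j).quotientModuleCat M i), ∃ y, extRes (hLK j) M i y = z

theorem IsIndExtIso.refl (K : ℕ → Ideal R) (hK : Antitone K) (M : ModuleCat.{u} R) :
    IsIndExtIso K K hK le_rfl M :=
  ⟨fun _ j _ hy => ⟨j, le_rfl, hy⟩, fun _ _ z => ⟨z, extRes_refl _ _ _ z⟩⟩

theorem IsIndExtIso.step {L : ℕ → Ideal R} {hLK : L ≤ K} {hLK' : L ≤ K'} {M : ModuleCat.{u} R}
    (H : IsIndExtIso K L hK hLK M) (hr : ∀ j f, r ^ (j + 1) * f ∈ K j → f ∈ K j)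
    (hM : ∀ m : M, r • m = 0)
    (hKK' : K' = fun j => K j ⊔ Ideal.span {r ^ (j + 1)}) :
    IsIndExtIso K' L hK' hLK' M := by
  subst hKK'
  refine ⟨fun i j y hy => ?_, fun i j z => ?_⟩
  · have hy' := hy
    rw [← extRes_extRes (hLK j) (le_sup_left : K j ≤ K j ⊔ Ideal.span {r ^ (j + 1)})] at hy'
    obtain ⟨j', h, hj'⟩ := H.exists_eq_zero i j _ hy'
    have h1 : extRes (le_sup_left : K j' ≤ K j' ⊔ Ideal.span {r ^ (j' + 1)}) M i
        (extRes (hK' h) M i y) = 0 := by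
      rw [extRes_extRes] at hj' ⊢
      exact hj'
    cases i with
    | zero => exact ⟨j', h, extRes_zero_injective M _ (h1.trans (map_zero _).symm)⟩
    | succ i =>
      obtain ⟨w, hw⟩ := extδ_surjective_of_extRes (hr j') M i _ h1
      refine ⟨j' + 1, by lia, ?_⟩
      rw [← extRes_extRes (hK' (Nat.le_succ j')) (hK' h), ← hw]
      refine (extRes_extδ (hr j') (hr (j' + 1)) (pow_succ' r (j' + 1)) (hK (Nat.le_succ j'))
        (hK' (Nat.le_succ j')) M i w).trans ?_
      rw [ext_smul_eq_zero hM, map_zero]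
  · obtain ⟨y, rfl⟩ := H.exists_eq i j z
    obtain ⟨y', rfl⟩ := exists_extRes_eq (hr j) M i y (by
      rw [pow_succ, mul_smul, ext_smul_eq_zero hM, smul_zero])
    exact ⟨y', (extRes_extRes _ _ _ _ _).symm⟩

end Step
end Ideal

open Limits in
theorem localCohomology.exists_maps (J : Ideal R) (i : ℕ) (M : ModuleCat.{u} R) :
    ∃ ι : ∀ m, Abelian.Ext (J ^ m).quotientModuleCat M i →ₗ[R] (localCohomology J i).obj M,
      (∀ z, ∃ m y, ι m y = z) ∧
      (∀ m m' (h : m ≤ m') y, ι m' (Ideal.extRes (Ideal.pow_le_pow_right h) M i y) = ι m y) ∧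
      (∀ m y, ι m y = 0 → ∃ (m' : ℕ) (h : m ≤ m'),
        Ideal.extRes (Ideal.pow_le_pow_right h) M i y = 0) ∧
      ∀ (A : Type u) [AddCommGroup A] [Module R A]
        (g : ∀ m, Abelian.Ext (J ^ m).quotientModuleCat M i →ₗ[R] A),
        (∀ m m' (h : m ≤ m') y,
          g m' (Ideal.extRes (Ideal.pow_le_pow_right h) M i y) = g m y) →
        ∃ G : (localCohomology J i).obj M →ₗ[R] A, ∀ m y, G (ι m y) = g m y := by
  let D := diagram (idealPowersDiagram J) i
  have := hasColimitDiagram.{u, 0} (idealPowersDiagram J) i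
  have : PreservesFilteredColimitsOfSize.{0, 0} (forget (ModuleCat.{u} R)) :=
    preservesFilteredColimitsOfSize_shrink _
  let ev : (ModuleCat.{u} R ⥤ ModuleCat.{u} R) ⥤ ModuleCat.{u} R := (evaluation _ _).obj M
  let F : ℕᵒᵖᵒᵖ ⥤ ModuleCat.{u} R := D ⋙ ev
  let c : Cocone F := ev.mapCocone (colimit.cocone D)
  have hc : IsColimit c := isColimitOfPreserves ev (colimit.isColimit D)
  let e (m : ℕ) : F.obj (Opposite.op (Opposite.op m)) ≃ₗ[R]
      Abelian.Ext (J ^ m).quotientModuleCat M i :=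
    ModuleCat.extEquiv (J ^ m).quotientModuleCat M i
  let w {m m' : ℕ} (h : m ≤ m') : (Opposite.op (Opposite.op m) : ℕᵒᵖᵒᵖ) ⟶
    Opposite.op (Opposite.op m') := (homOfLE h).op.op
  have he {m m' : ℕ} (h : m ≤ m') (x) : e m' ((F.map (w h)).hom x) =
      Ideal.extRes (Ideal.pow_le_pow_right h) M i (e m x) :=
    ModuleCat.extEquiv_naturality (Ideal.factorHom (Ideal.pow_le_pow_right h)) M i x
  have hcw {m m' : ℕ} (h : m ≤ m') (x) : (c.ι.app _).hom ((F.map (w h)).hom x) =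
      (c.ι.app _).hom x := DFunLike.congr_fun (congrArg ModuleCat.Hom.hom (c.w (w h))) x
  have hce (m : ℕ) (x) : ((c.ι.app (Opposite.op (Opposite.op m))).hom ∘ₗ (e m).symm.toLinearMap)
      (e m x) = (c.ι.app _).hom x := congrArg (c.ι.app _).hom ((e m).symm_apply_apply x)
  refine ⟨fun m => (c.ι.app (Opposite.op (Opposite.op m))).hom ∘ₗ (e m).symm.toLinearMap,
    fun z => ?_, fun m m' h y => ?_, fun m y hy => ?_, fun A _ _ g hg => ?_⟩
  · obtain ⟨⟨⟨m⟩⟩, x, hx⟩ := Concrete.isColimit_exists_rep F hc z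
    exact ⟨m, e m x, (hce m x).trans hx⟩
  · obtain ⟨x, rfl⟩ := (e m).surjective y
    rw [← he h]
    exact (hce _ _).trans ((hcw h x).trans (hce m x).symm)
  · obtain ⟨x, rfl⟩ := (e m).surjective y
    obtain ⟨⟨⟨m'⟩⟩, f, f', hf⟩ := Concrete.isColimit_exists_of_rep_eq F hc x 0
      (((hce m x).symm.trans hy).trans (map_zero (c.ι.app (Opposite.op (Opposite.op m))).hom).symm)
    have h : m ≤ m' := f.unop.unop.down.down
    refine ⟨m', h, (he h x).symm.trans ?_⟩
    exact (congrArg (e m') (hf.trans (map_zero (F.map f').hom))).trans (map_zero _)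
  · let s : Cocone F :=
      { pt := ModuleCat.of R A
        ι := { app := fun m => ModuleCat.ofHom (g m.unop.unop ∘ₗ (e m.unop.unop).toLinearMap)
               naturality := by
                rintro ⟨⟨m⟩⟩ ⟨⟨m'⟩⟩ f
                ext x
                have h : m ≤ m' := f.unop.unop.down.down
                exact (congrArg (g m') (he h x)).trans (hg m m' h (e m x)) } }
    refine ⟨(hc.desc s).hom, fun m y => ?_⟩
    refine (DFunLike.congr_fun (congrArg ModuleCat.Hom.hom (hc.fac s _)) _).trans ?_
    exact congrArg (g m) ((e m).apply_symm_apply y)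

namespace localCohomology

/-- Suppose that the ideals `K j` are cofinal with the powers of `J`, that the restriction maps
`Ext^i(R/K_j, M) → Ext^i(R/L_j, M)` form an ind-isomorphism, and that the `Ext^i(R/L_j, M)` are
concentrated in degree `c`, where they are `R/(I + L_j)`. Then the local cohomology of `M` with
respect to `J` is concentrated in degree `c`, where it is the colimit of the `R/(I + L_j)`. -/
theorem subsingleton_and_nonempty_equiv_directLimit {J I : Ideal R} {M : ModuleCat.{u} R}
    {K L Q : ℕ → Ideal R} {hK : Antitone K} {hL : Antitone L} {hLK : L ≤ K} {t : R} {c : ℕ}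
    (HL : Ideal.IsExtTower L hL M I t c) (HK : Ideal.IsIndExtIso K L hK hLK M)
    (hKJ : ∀ m, K m ≤ J ^ m) (hJK : ∀ j, ∃ m, J ^ m ≤ K j) (hQ : ∀ j, Q j = I ⊔ L j)
    (φ : ∀ j j', j ≤ j' → R ⧸ Q j →ₗ[R] R ⧸ Q j')
    (hφ : ∀ j j' h x, φ j j' h (Ideal.Quotient.mk _ x) =
      Ideal.Quotient.mk _ (t ^ (j' - j) * x)) :
    (∀ i, i ≠ c → Subsingleton ((localCohomology J i).obj M)) ∧
      Nonempty ((localCohomology J c).obj M ≃ₗ[R] Module.DirectLimit (fun j => R ⧸ Q j) φ) := by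
  have hLJ (m : ℕ) : L m ≤ J ^ m := (hLK m).trans (hKJ m)
  have key (i m m' : ℕ) (h : m ≤ m') (y : Abelian.Ext (J ^ m).quotientModuleCat M i)
      (hy : Ideal.extRes ((hL h).trans (hLJ m)) M i y = 0) :
      ∃ (m'' : ℕ) (h : m ≤ m''), Ideal.extRes (Ideal.pow_le_pow_right h) M i y = 0 := by
    rw [← Ideal.extRes_extRes (hLK m') ((hK h).trans (hKJ m))] at hy
    obtain ⟨j, hj, hy⟩ := HK.exists_eq_zero i m' _ hy
    obtain ⟨a, ha⟩ := hJK j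
    have ha' : J ^ (a + m) ≤ K j := (Ideal.pow_le_pow_right (Nat.le_add_right a m)).trans ha
    refine ⟨a + m, Nat.le_add_left m a, ?_⟩
    rw [Ideal.extRes_extRes] at hy
    rw [← Ideal.extRes_extRes ha' ((hK (h.trans hj)).trans (hKJ m)), hy, map_zero]
  refine ⟨fun i hi => ?_, ?_⟩
  · obtain ⟨ι, hsurj, hι, -, -⟩ := exists_maps J i M
    refine subsingleton_of_forall_eq 0 fun z => ?_
    obtain ⟨m, y, rfl⟩ := hsurj z
    obtain ⟨m', h, hy⟩ := key i m m le_rfl y (HL.eq_zero i m hi _)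
    rw [← hι m m' h, hy, map_zero]
  · obtain ⟨ι, hsurj, hι, -, hdesc⟩ := exists_maps J c M
    obtain ⟨Ψ, hΨs, hΨk, hΨn⟩ := HL.exists_map
    have he (j : ℕ) : ∃ e : Abelian.Ext (L j).quotientModuleCat M c ≃ₗ[R] R ⧸ Q j,
        ∀ f, e (Ψ j f) = Ideal.Quotient.mk (Q j) f :=
      LinearMap.exists_linearEquiv_of_ker_eq (Ψ j) (Q j).mkQ (hΨs j) (Q j).mkQ_surjective
        fun f => (hΨk j f).trans <| by
          rw [← hQ, Submodule.mkQ_apply, Submodule.Quotient.mk_eq_zero]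
    choose e he using he
    have hφe (j j' : ℕ) (h : j ≤ j') (y : Abelian.Ext (L j).quotientModuleCat M c) :
        φ j j' h (e j y) = e j' (Ideal.extRes (hL h) M c y) := by
      obtain ⟨f, rfl⟩ := hΨs j y
      rw [hΨn j j' h, he, he, hφ]
    have : DirectedSystem (fun j => R ⧸ Q j) (φ · · ·) :=
      { map_self := fun j x => by
          obtain ⟨x, rfl⟩ := Ideal.Quotient.mk_surjective x
          rw [hφ, Nat.sub_self, pow_zero, one_mul]
        map_map := fun a b d hab hbd x => by
          obtain ⟨x, rfl⟩ := Ideal.Quotient.mk_surjective x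
          rw [hφ, hφ, hφ, ← mul_assoc, ← pow_add]
          congr 4
          lia }
    obtain ⟨G, hG⟩ := hdesc (Module.DirectLimit (fun j => R ⧸ Q j) φ)
      (fun m => Module.DirectLimit.of R ℕ (fun j => R ⧸ Q j) φ m ∘ₗ (e m).toLinearMap ∘ₗ
        Ideal.extRes (hLJ m) M c) fun m m' h y => by
          simp only [LinearMap.comp_apply, LinearEquiv.coe_coe]
          rw [← Module.DirectLimit.of_f (hij := h), hφe, Ideal.extRes_extRes, Ideal.extRes_extRes]
    refine ⟨LinearEquiv.ofBijective G ⟨(injective_iff_map_eq_zero G).2 fun z hz => ?_,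
      fun w => ?_⟩⟩
    · obtain ⟨m, y, rfl⟩ := hsurj z
      rw [hG] at hz
      obtain ⟨m', h, hy⟩ := Module.DirectLimit.of.zero_exact hz
      rw [LinearMap.comp_apply, LinearEquiv.coe_coe, hφe, LinearEquiv.map_eq_zero_iff,
        Ideal.extRes_extRes] at hy
      obtain ⟨m'', h, hy⟩ := key c m m' h y hy
      rw [← hι m m'' h, hy, map_zero]
    · obtain ⟨j, x, rfl⟩ := Module.DirectLimit.exists_of w
      obtain ⟨y, hy⟩ := HK.exists_eq c j ((e j).symm x)
      obtain ⟨m, hm⟩ := hJK j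
      have hm' : J ^ (m + j) ≤ K j := (Ideal.pow_le_pow_right (Nat.le_add_right m j)).trans hm
      refine ⟨ι (m + j) (Ideal.extRes hm' M c y), ?_⟩
      have hj : j ≤ m + j := Nat.le_add_left j m
      rw [hG, ← Module.DirectLimit.of_f (hij := hj), ← (e j).apply_symm_apply x, hφe, ← hy]
      simp only [LinearMap.comp_apply, LinearEquiv.coe_coe, Ideal.extRes_extRes]

end localCohomology

namespace Ideal

/-- The ideal generated by the `x_i ^ (j + 1)` for `a ≤ i ≤ n`. -/
def spanPow (x : ℕ → R) (n a j : ℕ) : Ideal R :=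
  span ((fun i => x i ^ (j + 1)) '' Set.Icc a n)

theorem spanPow_antitone (x : ℕ → R) (n a : ℕ) : Antitone (spanPow x n a) := by
  intro j j' h
  rw [spanPow, span_le]
  rintro _ ⟨i, hi, rfl⟩
  exact mem_of_dvd _ (pow_dvd_pow _ (Nat.succ_le_succ h)) (subset_span ⟨i, hi, rfl⟩)

theorem spanPow_le_spanPow (x : ℕ → R) (n : ℕ) {a b : ℕ} (h : a ≤ b) :
    spanPow x n b ≤ spanPow x n a :=
  fun _ => span_mono (Set.image_mono (Set.Icc_subset_Icc_left h))

theorem spanPow_succ_self (x : ℕ → R) (n : ℕ) : spanPow x n (n + 1) = fun _ => ⊥ := by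
  ext1 j
  simp [spanPow]

theorem spanPow_eq_sup (x : ℕ → R) {n a : ℕ} (h : a ≤ n) :
    spanPow x n a = fun j => spanPow x n (a + 1) j ⊔ span {x a ^ (j + 1)} := by
  ext1 j
  rw [spanPow, spanPow, ← span_union, ← Set.insert_Icc_succ_left_eq_Icc h, Set.image_insert_eq,
    Set.union_singleton, Order.succ_eq_add_one]

section Sequence

variable {x : ℕ → R} {n k : ℕ}

theorem isExtTower_spanPow {I : Ideal R}
    (h₁ : ∀ a ≤ n, ∀ j f, x a ^ (j + 1) * f ∈ spanPow x n (a + 1) j → f ∈ spanPow x n (a + 1) j)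
    (h₂ : ∀ a, k ≤ a → a ≤ n → ∀ j f, x a ^ (j + 1) * f ∈ I ⊔ spanPow x n (a + 1) j →
      f ∈ I ⊔ spanPow x n (a + 1) j) (d a : ℕ) (hd : a + d = n + 1) (ha : k ≤ a) :
    IsExtTower (spanPow x n a) (spanPow_antitone x n a) I.quotientModuleCat I
      (∏ i ∈ Finset.Icc a n, x i) d := by
  induction d generalizing a with
  | zero =>
    obtain rfl : a = n + 1 := hd
    rw [Finset.Icc_eq_empty (by lia), Finset.prod_empty]
    simp only [spanPow_succ_self]
    exact isExtTower_bot I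
  | succ d ih =>
    have han : a ≤ n := by lia
    rw [← Finset.mul_prod_Ioc_eq_prod_Icc han, ← Finset.Icc_add_one_left_eq_Ioc]
    exact (ih (a + 1) (by lia) (by lia)).step (h₁ a han) (h₂ a ha han) (spanPow_eq_sup x han)

theorem isIndExtIso_spanPow {M : ModuleCat.{u} R}
    (h₁ : ∀ a ≤ n, ∀ j f, x a ^ (j + 1) * f ∈ spanPow x n (a + 1) j → f ∈ spanPow x n (a + 1) j)
    (hM : ∀ a < k, ∀ m : M, x a • m = 0)
    (hk : k ≤ n) (d a : ℕ) (hd : a + d = k) :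
    IsIndExtIso (spanPow x n a) (spanPow x n k) (spanPow_antitone x n a)
      (spanPow_le_spanPow x n (hd ▸ Nat.le_add_right a d)) M := by
  induction d generalizing a with
  | zero =>
    obtain rfl : a = k := hd
    exact .refl _ _ _
  | succ d ih =>
    exact (ih (a + 1) (by lia)).step (h₁ a (by lia)) (hM a (by lia))
      (spanPow_eq_sup x (by lia))

end Sequence

theorem spanPow_zero_le_pow (x : ℕ → R) (n m : ℕ) :
    spanPow x n 0 m ≤ span (x '' Set.Iio (n + 1)) ^ m := by
  rw [spanPow, span_le]
  rintro _ ⟨i, hi, rfl⟩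
  have hx : x i ∈ span (x '' Set.Iio (n + 1)) :=
    subset_span ⟨i, Nat.lt_succ_of_le hi.2, rfl⟩
  exact pow_le_pow_right m.le_succ (pow_mem_pow hx (m + 1))

theorem exists_pow_le_spanPow_zero (x : ℕ → R) (n j : ℕ) :
    ∃ m, span (x '' Set.Iio (n + 1)) ^ m ≤ spanPow x n 0 j := by
  refine exists_pow_le_of_le_radical_of_fg ?_
    (Submodule.fg_span ((Set.finite_Iio (n + 1)).image x))
  refine span_le.2 ?_
  rintro _ ⟨i, hi, rfl⟩
  exact ⟨j + 1, subset_span ⟨i, ⟨i.zero_le, Nat.le_of_lt_succ hi⟩, rfl⟩⟩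

end Ideal

theorem localCohomology.subsingleton_and_nonempty_equiv_of_spanPow {x : ℕ → R} {n k : ℕ}
    (hk : k ≤ n) {I : Ideal R} (hI : I = Ideal.span (x '' Set.Iio k))
    (h₁ : ∀ a ≤ n, ∀ j f, x a ^ (j + 1) * f ∈ Ideal.spanPow x n (a + 1) j →
      f ∈ Ideal.spanPow x n (a + 1) j)
    (h₂ : ∀ a, k ≤ a → a ≤ n → ∀ j f, x a ^ (j + 1) * f ∈ I ⊔ Ideal.spanPow x n (a + 1) j →
      f ∈ I ⊔ Ideal.spanPow x n (a + 1) j)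
    {Q : ℕ → Ideal R} (hQ : ∀ j, Q j = I ⊔ Ideal.spanPow x n k j)
    (φ : ∀ j j', j ≤ j' → R ⧸ Q j →ₗ[R] R ⧸ Q j')
    (hφ : ∀ j j' h y, φ j j' h (Ideal.Quotient.mk _ y) =
      Ideal.Quotient.mk _ ((∏ i ∈ Finset.Icc k n, x i) ^ (j' - j) * y)) :
    (∀ i, i ≠ n + 1 - k → Subsingleton ((localCohomology (Ideal.span (x '' Set.Iio (n + 1))) i).obj
      I.quotientModuleCat)) ∧
      Nonempty ((localCohomology (Ideal.span (x '' Set.Iio (n + 1))) (n + 1 - k)).obj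
        I.quotientModuleCat ≃ₗ[R] Module.DirectLimit (fun j => R ⧸ Q j) φ) := by
  refine subsingleton_and_nonempty_equiv_directLimit
    (Ideal.isExtTower_spanPow h₁ h₂ (n + 1 - k) k (by lia) le_rfl)
    (Ideal.isIndExtIso_spanPow h₁ (fun a ha m => ?_) hk k 0 (Nat.zero_add k))
    (Ideal.spanPow_zero_le_pow x n) (Ideal.exists_pow_le_spanPow_zero x n) hQ φ hφ
  obtain ⟨m, rfl⟩ := Ideal.Quotient.mk_surjective m
  refine (Ideal.Quotient.eq_zero_iff_mem (I := I) (a := x a * m)).2 (I.mul_mem_right m ?_)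
  rw [hI]
  exact Ideal.subset_span ⟨a, ha, rfl⟩

end

namespace MvPolynomial

variable {σ A : Type*} [CommRing A]

theorem mem_span_C_sup_span_monomial {c : A} {S : Set (σ →₀ ℕ)} {f : MvPolynomial σ A} :
    f ∈ Ideal.span {C c} ⊔ Ideal.span ((fun s => monomial s (1 : A)) '' S) ↔
      ∀ m, c ∣ coeff m f ∨ ∃ s ∈ S, s ≤ m := by
  constructor
  · intro hf m
    obtain ⟨g, hg, h, hh, rfl⟩ := Submodule.mem_sup.1 hf
    refine or_iff_not_imp_right.2 fun hm => ?_
    rw [mem_ideal_span_monomial_image] at hh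
    have h0 : coeff m h = 0 := notMem_support_iff.1 fun hmem => hm (hh m hmem)
    rw [coeff_add, h0, add_zero]
    exact (C_dvd_iff_dvd_coeff c g).1 (Ideal.mem_span_singleton.1 hg) m
  · intro h
    rw [← support_sum_monomial_coeff f]
    refine Ideal.sum_mem _ fun m _ => ?_
    obtain ⟨b, hb⟩ | ⟨s, hs, hsm⟩ := h m
    · refine Ideal.mem_sup_left (Ideal.mem_span_singleton.2 ⟨monomial m b, ?_⟩)
      rw [hb, C_mul_monomial]
    · refine Ideal.mem_sup_right (Ideal.mem_of_dvd _ ⟨monomial (m - s) (coeff m f), ?_⟩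
        (Ideal.subset_span ⟨s, hs, rfl⟩))
      rw [monomial_mul, one_mul, add_tsub_cancel_of_le hsm]

theorem mem_of_X_pow_mul_mem {c : A} {S : Set (σ →₀ ℕ)} {i : σ} (hS : ∀ s ∈ S, s i = 0) {N : ℕ}
    {f : MvPolynomial σ A}
    (h : X i ^ N * f ∈ Ideal.span {C c} ⊔ Ideal.span ((fun s => monomial s (1 : A)) '' S)) :
    f ∈ Ideal.span {C c} ⊔ Ideal.span ((fun s => monomial s (1 : A)) '' S) := by
  rw [mem_span_C_sup_span_monomial] at h ⊢
  intro m
  have hm := h (Finsupp.single i N + m)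
  rw [X_pow_eq_monomial, coeff_monomial_mul, one_mul] at hm
  refine hm.imp_right ?_
  rintro ⟨s, hs, hsm⟩
  refine ⟨s, hs, fun l => ?_⟩
  by_cases hl : l = i
  · subst hl
    rw [hS s hs]
    exact Nat.zero_le _
  · simpa [Finsupp.single_apply, Ne.symm hl] using hsm l

theorem mem_of_C_mul_mem {c q : A} (hq : ∀ b, c ∣ q * b → c ∣ b) {S : Set (σ →₀ ℕ)}
    {f : MvPolynomial σ A}
    (h : C q * f ∈ Ideal.span {C c} ⊔ Ideal.span ((fun s => monomial s (1 : A)) '' S)) :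
    f ∈ Ideal.span {C c} ⊔ Ideal.span ((fun s => monomial s (1 : A)) '' S) := by
  rw [mem_span_C_sup_span_monomial] at h ⊢
  intro m
  have hm := h m
  rw [coeff_C_mul] at hm
  exact hm.imp_left (hq _)

end MvPolynomial

open MvPolynomial in
theorem Iideal_sup_spanPow (p : ℕ) (hp : p.Prime) (k n a j : ℕ) :
    Iideal p hp k ⊔ Ideal.spanPow (vGen p hp) n (a + 1) j =
      Ideal.span {C (if k = 0 then 0 else (p : ZLoc p hp))} ⊔
        Ideal.span ((fun s => monomial s (1 : ZLoc p hp)) ''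
          ((fun i => Finsupp.single i 1) '' {i | i + 1 < k} ∪
            (fun i => Finsupp.single i (j + 1)) '' {i | a ≤ i ∧ i + 1 ≤ n})) := by
  have h₁ : (fun s => monomial s (1 : ZLoc p hp)) ''
      ((fun i => Finsupp.single i (j + 1)) '' {i | a ≤ i ∧ i + 1 ≤ n}) =
      (fun i => vGen p hp i ^ (j + 1)) '' Set.Icc (a + 1) n := by
    rw [Set.image_image]
    ext f
    constructor
    · rintro ⟨i, hi, rfl⟩
      exact ⟨i + 1, ⟨Nat.succ_le_succ hi.1, hi.2⟩, X_pow_eq_monomial⟩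
    · rintro ⟨_ | i, hi, rfl⟩
      · exact absurd hi.1 (by lia)
      · exact ⟨i, ⟨Nat.le_of_succ_le_succ hi.1, hi.2⟩, X_pow_eq_monomial.symm⟩
  have h₂ : Ideal.span (vGen p hp '' Set.Iio k) =
      Ideal.span {C (if k = 0 then 0 else (p : ZLoc p hp))} ⊔
        Ideal.span ((fun s => monomial s (1 : ZLoc p hp)) ''
          ((fun i => Finsupp.single i 1) '' {i | i + 1 < k})) := by
    rw [Set.image_image]
    cases k with
    | zero => simp
    | succ k =>
      rw [← Ideal.span_union, if_neg k.succ_ne_zero]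
      congr 1
      ext f
      constructor
      · rintro ⟨_ | i, hi, rfl⟩
        · exact Or.inl (map_natCast C p).symm
        · exact Or.inr ⟨i, hi, rfl⟩
      · rintro (rfl | ⟨i, hi, rfl⟩)
        · exact ⟨0, k.succ_pos, (map_natCast C p).symm⟩
        · exact ⟨i + 1, hi, rfl⟩
  rw [Set.image_union, Ideal.span_union, h₁, ← sup_assoc, ← h₂]
  rfl

theorem mem_of_vGen_pow_mul_mem (p : ℕ) (hp : p.Prime) {k n a j : ℕ} (hka : k ≤ a)
    {f : BPRing p hp}
    (h : vGen p hp a ^ (j + 1) * f ∈ Iideal p hp k ⊔ Ideal.spanPow (vGen p hp) n (a + 1) j) :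
    f ∈ Iideal p hp k ⊔ Ideal.spanPow (vGen p hp) n (a + 1) j := by
  rw [Iideal_sup_spanPow] at h ⊢
  cases a with
  | zero =>
    obtain rfl : k = 0 := Nat.le_zero.1 hka
    have := span_p_isPrime p hp
    have hp0 : (p : ZLoc p hp) ^ (j + 1) ≠ 0 := by
      have : CharZero (ZLoc p hp) := charZero_of_injective_algebraMap
        (IsLocalization.injective (ZLoc p hp)
          (Ideal.primeCompl_le_nonZeroDivisors (Ideal.span {(p : ℤ)})))
      exact pow_ne_zero _ (Nat.cast_ne_zero.2 hp.ne_zero)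
    have hv : vGen p hp 0 ^ (j + 1) = MvPolynomial.C ((p : ZLoc p hp) ^ (j + 1)) := by
      rw [map_pow, map_natCast]
      rfl
    rw [hv] at h
    refine MvPolynomial.mem_of_C_mul_mem (fun b hb => ?_) h
    rw [if_pos rfl, zero_dvd_iff] at hb ⊢
    exact (mul_eq_zero.1 hb).resolve_left hp0
  | succ a =>
    refine MvPolynomial.mem_of_X_pow_mul_mem (i := a) ?_ h
    rintro s (⟨i, hi, rfl⟩ | ⟨i, hi, rfl⟩)
    · have hi : i + 1 < k := hi
      exact Finsupp.single_eq_of_ne (by lia)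
    · have hi : a + 1 ≤ i ∧ _ := hi
      exact Finsupp.single_eq_of_ne (by lia)

theorem Jideal_eq_sup_spanPow (p : ℕ) (hp : p.Prime) (k n j : ℕ) :
    Jideal p hp k n j = Iideal p hp k ⊔ Ideal.spanPow (vGen p hp) n k j :=
  Ideal.span_union _ _

/-- With `R = ℤ_(p)[v_1, v_2, …]`, `v_0 = p`, `I_m = (v_0, …, v_{m-1})`, and
`0 ≤ k ≤ n`: the local cohomology `H_{I_{n+1}}^i(R/I_k)` vanishes for `i ≠ n + 1 - k`, and
`H_{I_{n+1}}^{n+1-k}(R/I_k)` is isomorphic to the colimit over `j` of the modules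
`R/(v_0, …, v_{k-1}, v_k^j, …, v_n^j)` with transition maps induced by multiplication by
`v_k v_{k+1} ⋯ v_n`. -/
theorem stmt18 (p : ℕ) (hp : p.Prime) (n k : ℕ) (hk : k ≤ n) :
    (∀ i : ℕ, i ≠ n + 1 - k →
      Subsingleton ((localCohomology (Iideal p hp (n + 1)) i).obj
        (ModuleCat.of (BPRing p hp) (BPRing p hp ⧸ Iideal p hp k)))) ∧
    Nonempty (((localCohomology (Iideal p hp (n + 1)) (n + 1 - k)).obj
        (ModuleCat.of (BPRing p hp) (BPRing p hp ⧸ Iideal p hp k))) ≃ₗ[BPRing p hp]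
      Module.DirectLimit (fun j : ℕ => BPRing p hp ⧸ Jideal p hp k n j)
        (towerMap p hp k n hk)) := by
  have h (k a j : ℕ) (hka : k ≤ a) (f : BPRing p hp) := mem_of_vGen_pow_mul_mem p hp (n := n)
    (j := j) (f := f) hka
  refine localCohomology.subsingleton_and_nonempty_equiv_of_spanPow hk rfl
    (fun a _ j f hf => ?_) (fun a hka _ j f => h k a j hka f)
    (Jideal_eq_sup_spanPow p hp k n) (towerMap p hp k n hk) fun _ _ _ _ => rfl
  have h0 : Iideal p hp 0 ⊔ Ideal.spanPow (vGen p hp) n (a + 1) j =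
      Ideal.spanPow (vGen p hp) n (a + 1) j := by
    simp [Iideal]
  have := h 0 a j a.zero_le f
  rw [h0] at this
  exact this hf
end
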